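/- arXiv:2308.01461 — 5 statements merged into one kernel-verified Lean document; each statement's English description precedes it below -/
import Mathlib

section
/- Let G_1, G_2, ..., G_c be c ≥ 4 directed graphs on a common set of n vertices. If e(G_i) > (1/2)n^2 for every i ∈ {1,...,c}, then there exists a rainbow directed triangle and there exists a rainbow transitive triangle. -/
/-- No three distinct colors can be chosen from `X`, `Y`, `Z` respectively. -/
def RainbowFree (X Y Z : Finset (Fin 4)) : Prop :=
  ∀ i ∈ X, ∀ j ∈ Y, ∀ k ∈ Z, i ≠ j → j ≠ k → i ≠ k → False

lemma RainbowFree.card_add_card_le {X Y Z : Finset (Fin 4)} (h : RainbowFree X Y Z)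
    (hX : 2 ≤ X.card) : Y.card + Z.card ≤ 4 := by
  obtain ⟨x, hx, y, hy, hxy⟩ := Finset.one_lt_card.mp hX
  have key : ∀ {P Q : Finset (Fin 4)}, RainbowFree X P Q →
      ∀ z ∈ P, z ≠ x → z ≠ y → Q ⊆ {z} := by
    intro P Q hPQ z hz hzx hzy q hq
    by_contra hqz
    simp only [Finset.mem_singleton] at hqz
    by_cases hqx : q = x
    · exact hPQ y hy z hz q hq hzy.symm (Ne.symm hqz) (by rw [hqx]; exact hxy.symm)
    · exact hPQ x hx z hz q hq hzx.symm (Ne.symm hqz) (Ne.symm hqx)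
  have h' : RainbowFree X Z Y :=
    fun i hi j hj k hk hij hjk hik => h i hi k hk j hj hik hjk.symm hij
  have hY4 : Y.card ≤ 4 := by simpa using Y.card_le_univ
  have hZ4 : Z.card ≤ 4 := by simpa using Z.card_le_univ
  have aux : ∀ {P Q : Finset (Fin 4)}, P.card ≤ 4 →
      RainbowFree X P Q →
      RainbowFree X Q P →
      ∀ z ∈ P, z ≠ x → z ≠ y → P.card + Q.card ≤ 4 := by
    intro P Q hP hPQ hQP z hz hzx hzy
    have hQ := key hPQ z hz hzx hzy
    rcases Finset.subset_singleton_iff.mp hQ with rfl | rfl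
    · simpa using hP
    · have := Finset.card_le_card (key hQP z (by simp) hzx hzy)
      simp at this ⊢
      omega
  by_cases hY : Y ⊆ {x, y}
  · by_cases hZ : Z ⊆ {x, y}
    · have h1 := Finset.card_le_card hY
      have h2 := Finset.card_le_card hZ
      rw [Finset.card_pair hxy] at h1 h2
      omega
    · obtain ⟨z, hz, hzn⟩ := Finset.not_subset.mp hZ
      simp only [Finset.mem_insert, Finset.mem_singleton, not_or] at hzn
      have := aux hZ4 h' h z hz hzn.1 hzn.2
      omega
  · obtain ⟨z, hz, hzn⟩ := Finset.not_subset.mp hY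
    simp only [Finset.mem_insert, Finset.mem_singleton, not_or] at hzn
    exact aux hY4 h h' z hz hzn.1 hzn.2

lemma card_of_forall_eq {α : Type*} {Y Z : Finset α} (h : ∀ j ∈ Y, ∀ k ∈ Z, j = k) :
    Y.card = 0 ∨ Z.card = 0 ∨ (Y.card = 1 ∧ Z.card = 1) := by
  rcases Y.eq_empty_or_nonempty with rfl | ⟨y, hy⟩
  · simp
  rcases Z.eq_empty_or_nonempty with rfl | ⟨z, hz⟩
  · simp
  refine Or.inr (Or.inr ⟨Finset.card_eq_one.mpr ⟨z, ?_⟩, Finset.card_eq_one.mpr ⟨y, ?_⟩⟩)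
  · exact Finset.eq_singleton_iff_unique_mem.mpr ⟨h y hy z hz ▸ hy, fun x hx => h x hx z hz⟩
  · exact Finset.eq_singleton_iff_unique_mem.mpr
      ⟨(h y hy z hz).symm ▸ hz, fun x hx => (h y hy x hx).symm⟩

lemma RainbowFree.card_of_three_le {X Y Z : Finset (Fin 4)} (h : RainbowFree X Y Z)
    (hX : 3 ≤ X.card) : Y.card = 0 ∨ Z.card = 0 ∨ (Y.card = 1 ∧ Z.card = 1) := by
  refine card_of_forall_eq fun j hj k hk => ?_
  by_contra hjk
  have hlt : ({j, k} : Finset (Fin 4)).card < X.card :=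
    lt_of_le_of_lt Finset.card_le_two (by omega)
  obtain ⟨i, hi, hin⟩ := Finset.exists_mem_notMem_of_card_lt_card hlt
  simp only [Finset.mem_insert, Finset.mem_singleton, not_or] at hin
  exact h i hi j hj k hk hin.1 hjk hin.2

lemma RainbowFree.card_of_nonempty {X Y Z : Finset (Fin 4)} (h : RainbowFree X Y Z)
    (hX : X.Nonempty) : Y.card ≤ 1 ∨ Z.card ≤ 1 ∨ (Y.card ≤ 2 ∧ Z.card ≤ 2) := by
  obtain ⟨x, hx⟩ := hX
  have h0 := card_of_forall_eq (Y := Y.erase x) (Z := Z.erase x) fun j hj k hk => by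
    by_contra hjk
    rw [Finset.mem_erase] at hj hk
    exact h x hx j hj.2 k hk.2 hj.1.symm hjk hk.1.symm
  have hY := Y.pred_card_le_card_erase (a := x)
  have hZ := Z.pred_card_le_card_erase (a := x)
  omega

/-- The number of colored edges inside `S`, where `col u v` is the set of colors of `uv`. -/
def colorWeight {V : Type*} (col : V → V → Finset (Fin 4)) (S : Finset V) : ℕ :=
  ∑ u ∈ S, ∑ v ∈ S, (col u v).card

lemma colorWeight_le_of_forall_pair {V : Type*} (col : V → V → Finset (Fin 4)) (S : Finset V)
    (h : ∀ u ∈ S, ∀ v ∈ S, (col u v).card + (col v u).card ≤ 4) :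
    colorWeight col S ≤ 2 * S.card ^ 2 := by
  have h1 : 2 * colorWeight col S = ∑ u ∈ S, ∑ v ∈ S, ((col u v).card + (col v u).card) := by
    simp only [Finset.sum_add_distrib]
    rw [Finset.sum_comm (f := fun u v => (col v u).card), two_mul, colorWeight]
  have h2 : ∑ u ∈ S, ∑ v ∈ S, ((col u v).card + (col v u).card) ≤ ∑ u ∈ S, ∑ v ∈ S, 4 :=
    Finset.sum_le_sum fun u hu => Finset.sum_le_sum fun v hv => h u hu v hv
  simp only [Finset.sum_const, smul_eq_mul] at h2
  nlinarith

lemma sum_eq_add_add_sum_erase_erase {V : Type*} [DecidableEq V] {M : Type*} [AddCommMonoid M]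
    {S : Finset V} {u v : V}
    (hu : u ∈ S) (hv : v ∈ S) (huv : u ≠ v) (f : V → M) :
    ∑ w ∈ S, f w = f u + (f v + ∑ w ∈ (S.erase u).erase v, f w) := by
  rw [Finset.add_sum_erase _ _ (Finset.mem_erase.mpr ⟨huv.symm, hv⟩), Finset.add_sum_erase _ _ hu]

/-- Deleting a pair of vertices incident to few colored edges preserves the bound. -/
lemma colorWeight_le_of_erase_pair {V : Type*} [DecidableEq V] (col : V → V → Finset (Fin 4))
    (hcol : ∀ u, col u u = ∅) {S : Finset V} {u v : V} (hu : u ∈ S) (hv : v ∈ S) (huv : u ≠ v)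
    (hS : colorWeight col ((S.erase u).erase v) ≤ 2 * ((S.erase u).erase v).card ^ 2)
    (hT : (col u v).card + (col v u).card + ∑ w ∈ (S.erase u).erase v,
      ((col u w).card + (col w u).card + (col v w).card + (col w v).card) ≤
        8 * ((S.erase u).erase v).card + 8) :
    colorWeight col S ≤ 2 * S.card ^ 2 := by
  have hc : S.card = ((S.erase u).erase v).card + 2 := by
    have h1 := Finset.card_erase_add_one (Finset.mem_erase.mpr ⟨huv.symm, hv⟩)
    have h2 := Finset.card_erase_add_one hu
    omega
  unfold colorWeight at hS ⊢
  rw [hc]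
  simp only [sum_eq_add_add_sum_erase_erase hu hv huv, Finset.sum_add_distrib, hcol,
    Finset.card_empty] at hT ⊢
  nlinarith

lemma colorWeight_le_of_no_transitive {V : Type*} [DecidableEq V] (col : V → V → Finset (Fin 4))
    (hcol : ∀ u, col u u = ∅)
    (h : ∀ u v w, u ≠ v → v ≠ w → u ≠ w → RainbowFree (col u v) (col v w) (col u w))
    (S : Finset V) : colorWeight col S ≤ 2 * S.card ^ 2 := by
  induction S using Finset.strongInduction with
  | H S ih =>
  by_cases hex : ∃ u ∈ S, ∃ v ∈ S, 2 ≤ (col u v).card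
  · obtain ⟨u, hu, v, hv, h2⟩ := hex
    have huv : u ≠ v := by
      rintro rfl
      simp [hcol] at h2
    refine colorWeight_le_of_erase_pair col hcol hu hv huv
      (ih _ ((Finset.erase_subset _ _).trans_ssubset (Finset.erase_ssubset hu))) ?_
    have h4 : ∀ a b, (col a b).card ≤ 4 := fun a b => by simpa using (col a b).card_le_univ
    have hsum : ∑ w ∈ (S.erase u).erase v,
        ((col u w).card + (col w u).card + (col v w).card + (col w v).card) ≤
          ∑ w ∈ (S.erase u).erase v, 8 := by
      refine Finset.sum_le_sum fun w hw => ?_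
      simp only [Finset.mem_erase] at hw
      have h1 := (h u v w huv (Ne.symm hw.1) (Ne.symm hw.2.1)).card_add_card_le h2
      have hr : RainbowFree (col u v) (col w u) (col w v) :=
        fun i hi j hj k hk hij hjk hik =>
          h w u v hw.2.1 huv hw.1 j hj i hi k hk hij.symm hik hjk
      have h3 := hr.card_add_card_le h2
      omega
    rw [Finset.sum_const, smul_eq_mul] at hsum
    have := h4 u v
    have := h4 v u
    omega
  · push Not at hex
    refine colorWeight_le_of_forall_pair col S fun u hu v hv => ?_
    have := hex u hu v hv
    have := hex v hv u hu
    omega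

/-- Some edge of a nonempty finite directed graph goes from a vertex to one whose difference of
out-degree and in-degree is not larger. -/
lemma exists_edge_imbalance_le {V : Type*} (S : Finset V) (H : V → V → Prop) [DecidableRel H]
    (hH : ∃ u ∈ S, ∃ v ∈ S, H u v) :
    ∃ u ∈ S, ∃ v ∈ S, H u v ∧
      (∑ w ∈ S, (if H v w then (1 : ℤ) else 0)) - ∑ w ∈ S, (if H w v then (1 : ℤ) else 0) ≤
      (∑ w ∈ S, (if H u w then (1 : ℤ) else 0)) - ∑ w ∈ S, (if H w u then (1 : ℤ) else 0) := by
  let f : V → ℤ := fun u =>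
    (∑ w ∈ S, (if H u w then (1 : ℤ) else 0)) - ∑ w ∈ S, (if H w u then (1 : ℤ) else 0)
  by_contra! hcon
  replace hcon : ∀ u ∈ S, ∀ v ∈ S, H u v → f u < f v := hcon
  have hsq : ∑ u ∈ S, ∑ v ∈ S, (if H u v then (1 : ℤ) else 0) * (f u - f v) =
      ∑ u ∈ S, f u * f u := by
    simp only [mul_sub, Finset.sum_sub_distrib]
    rw [Finset.sum_comm (f := fun u v => (if H u v then (1 : ℤ) else 0) * f v),
      ← Finset.sum_sub_distrib]
    refine Finset.sum_congr rfl fun u _ => ?_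
    rw [← Finset.sum_mul, ← Finset.sum_mul, ← sub_mul]
  have hnonneg : 0 ≤ ∑ u ∈ S, f u * f u := Finset.sum_nonneg fun u _ => mul_self_nonneg _
  have hle : ∀ u ∈ S, ∀ v ∈ S, (if H u v then (1 : ℤ) else 0) * (f u - f v) ≤ 0 := by
    intro u hu v hv
    split_ifs with huv
    · linarith [hcon u hu v hv huv]
    · simp
  obtain ⟨u, hu, v, hv, huv⟩ := hH
  have hlt : ∑ u ∈ S, ∑ v ∈ S, (if H u v then (1 : ℤ) else 0) * (f u - f v) < 0 := by
    refine Finset.sum_neg' (fun u hu => Finset.sum_nonpos (hle u hu)) ⟨u, hu, ?_⟩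
    refine Finset.sum_neg' (hle u hu) ⟨v, hv, ?_⟩
    rw [if_pos huv, one_mul]
    linarith [hcon u hu v hv huv]
  linarith

lemma colorWeight_le_of_no_directed {V : Type*} [DecidableEq V] (col : V → V → Finset (Fin 4))
    (hcol : ∀ u, col u u = ∅)
    (h : ∀ u v w, u ≠ v → v ≠ w → u ≠ w → RainbowFree (col u v) (col v w) (col w u))
    (S : Finset V) : colorWeight col S ≤ 2 * S.card ^ 2 := by
  have h4 : ∀ a b, (col a b).card ≤ 4 := fun a b => by simpa using (col a b).card_le_univ
  induction S using Finset.strongInduction with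
  | H S ih =>
  by_cases hex : ∃ u ∈ S, ∃ v ∈ S, 2 ≤ (col u v).card ∧ 2 ≤ (col v u).card
  · obtain ⟨u, hu, v, hv, h2, h2'⟩ := hex
    have huv : u ≠ v := by
      rintro rfl
      simp [hcol] at h2
    refine colorWeight_le_of_erase_pair col hcol hu hv huv
      (ih _ ((Finset.erase_subset _ _).trans_ssubset (Finset.erase_ssubset hu))) ?_
    have hsum : ∑ w ∈ (S.erase u).erase v,
        ((col u w).card + (col w u).card + (col v w).card + (col w v).card) ≤
          ∑ w ∈ (S.erase u).erase v, 8 := by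
      refine Finset.sum_le_sum fun w hw => ?_
      simp only [Finset.mem_erase] at hw
      have h1 := (h u v w huv (Ne.symm hw.1) (Ne.symm hw.2.1)).card_add_card_le h2
      have h3 := (h v u w huv.symm (Ne.symm hw.2.1) (Ne.symm hw.1)).card_add_card_le h2'
      omega
    rw [Finset.sum_const, smul_eq_mul] at hsum
    have := h4 u v
    have := h4 v u
    omega
  push Not at hex
  let H : V → V → Prop := fun u v => (col u v).card = 4 ∧ (col v u).card = 1
  have : DecidableRel H := fun u v => inferInstanceAs (Decidable (_ ∧ _))
  by_cases hH : ∃ u ∈ S, ∃ v ∈ S, H u v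
  · obtain ⟨u, hu, v, hv, huv', hf⟩ := exists_edge_imbalance_le S H hH
    obtain ⟨hA, hB⟩ : (col u v).card = 4 ∧ (col v u).card = 1 := huv'
    have huv : u ≠ v := by
      rintro rfl
      simp [hcol] at hA
    refine colorWeight_le_of_erase_pair col hcol hu hv huv
      (ih _ ((Finset.erase_subset _ _).trans_ssubset (Finset.erase_ssubset hu))) ?_
    have hsum : ∑ w ∈ (S.erase u).erase v,
        (((col u w).card + (col w u).card + (col v w).card + (col w v).card : ℕ) : ℤ) ≤
          ∑ w ∈ (S.erase u).erase v, (8 + (if H w u then (1 : ℤ) else 0)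
            + (if H v w then (1 : ℤ) else 0) - (if H u w then (1 : ℤ) else 0)
            - (if H w v then (1 : ℤ) else 0)) := by
      refine Finset.sum_le_sum fun w hw => ?_
      simp only [Finset.mem_erase] at hw
      have h1 := (h u v w huv (Ne.symm hw.1) (Ne.symm hw.2.1)).card_of_three_le (by omega)
      have h3 := (h v u w huv.symm (Ne.symm hw.2.1) (Ne.symm hw.1)).card_of_nonempty
        (Finset.card_pos.mp (by omega))
      have e1 := hex u hu w hw.2.2
      have e2 := hex v hv w hw.2.2
      have := h4 u w
      have := h4 w u
      have := h4 v w
      have := h4 w v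
      simp only [H]
      split_ifs <;> omega
    have hself : ∀ a, ¬ H a a := fun a ha => by
      have : (col a a).card = 4 := ha.1
      simp [hcol] at this
    have hvu : ¬ H v u := fun hvu => by
      have : (col v u).card = 4 := hvu.1
      omega
    simp only [sum_eq_add_add_sum_erase_erase hu hv huv, if_neg (hself _), if_neg hvu,
      if_pos (show H u v from ⟨hA, hB⟩)] at hf
    simp only [Finset.sum_sub_distrib, Finset.sum_add_distrib (s := (S.erase u).erase v) (M := ℤ),
      Finset.sum_const, nsmul_eq_mul] at hsum
    rw [← Nat.cast_sum] at hsum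
    omega
  · push Not at hH
    refine colorWeight_le_of_forall_pair col S fun u hu v hv => ?_
    have e1 := hex u hu v hv
    have e2 : ¬ ((col u v).card = 4 ∧ (col v u).card = 1) := hH u hu v hv
    have e3 : ¬ ((col v u).card = 4 ∧ (col u v).card = 1) := hH v hv u hu
    have := h4 u v
    have := h4 v u
    omega

/-- The colors among the first four of the edge `uv`. -/
def firstFourColors {V : Type*} [DecidableEq V] {c : ℕ} (hc : 4 ≤ c) (G : Fin c → Finset (V × V))
    (u v : V) : Finset (Fin 4) :=
  Finset.univ.filter fun i => (u, v) ∈ G (Fin.castLE hc i)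

lemma colorWeight_firstFourColors {V : Type*} [DecidableEq V] [Fintype V] {c : ℕ} (hc : 4 ≤ c)
    (G : Fin c → Finset (V × V)) :
    colorWeight (firstFourColors hc G) Finset.univ = ∑ i, (G (Fin.castLE hc i)).card := by
  simp only [colorWeight, firstFourColors, Finset.card_filter]
  rw [← Fintype.sum_prod_type' (f := fun u v => ∑ i, if (u, v) ∈ G (Fin.castLE hc i) then 1 else 0),
    Finset.sum_comm]
  simp

/-- If `c ≥ 4` directed graphs on a common set of `n` vertices each have more
than `(1/2)n^2` edges, then there is a rainbow directed triangle and a rainbow transitive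
triangle. Directed graphs are modelled as finite sets of ordered pairs of distinct vertices. -/
theorem rainbow_triangles_of_many_edges_four_colors
    (n c : ℕ) (hc : 4 ≤ c) (G : Fin c → Finset (Fin n × Fin n))
    (hloop : ∀ i : Fin c, ∀ e ∈ G i, e.1 ≠ e.2)
    (hE : ∀ i : Fin c, ((G i).card : ℝ) > (1 / 2 : ℝ) * (n : ℝ) ^ 2) :
    (∃ u v w : Fin n, ∃ i j k : Fin c,
        u ≠ v ∧ v ≠ w ∧ u ≠ w ∧ i ≠ j ∧ j ≠ k ∧ i ≠ k ∧
        (u, v) ∈ G i ∧ (v, w) ∈ G j ∧ (w, u) ∈ G k) ∧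
    (∃ u v w : Fin n, ∃ i j k : Fin c,
        u ≠ v ∧ v ≠ w ∧ u ≠ w ∧ i ≠ j ∧ j ≠ k ∧ i ≠ k ∧
        (u, v) ∈ G i ∧ (v, w) ∈ G j ∧ (u, w) ∈ G k) := by
  have hcol : ∀ u, firstFourColors hc G u u = ∅ := fun u =>
    Finset.filter_eq_empty_iff.mpr fun i _ hi => hloop _ _ hi rfl
  have hW : 2 * n ^ 2 < colorWeight (firstFourColors hc G) Finset.univ := by
    rw [colorWeight_firstFourColors, ← Nat.cast_lt (α := ℝ)]
    push_cast
    rw [Fin.sum_univ_four]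
    linarith [hE (Fin.castLE hc 0), hE (Fin.castLE hc 1), hE (Fin.castLE hc 2),
      hE (Fin.castLE hc 3)]
  have hinj := Fin.castLE_injective hc
  constructor
  · by_contra hcon
    have := colorWeight_le_of_no_directed _ hcol
      (fun u v w huv hvw huw i hi j hj k hk hij hjk hik => hcon
        ⟨u, v, w, _, _, _, huv, hvw, huw, hinj.ne hij, hinj.ne hjk, hinj.ne hik,
          (Finset.mem_filter.mp hi).2, (Finset.mem_filter.mp hj).2, (Finset.mem_filter.mp hk).2⟩)
      Finset.univ
    rw [Finset.card_fin] at this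
    omega
  · by_contra hcon
    have := colorWeight_le_of_no_transitive _ hcol
      (fun u v w huv hvw huw i hi j hj k hk hij hjk hik => hcon
        ⟨u, v, w, _, _, _, huv, hvw, huw, hinj.ne hij, hinj.ne hjk, hinj.ne hik,
          (Finset.mem_filter.mp hi).2, (Finset.mem_filter.mp hj).2, (Finset.mem_filter.mp hk).2⟩)
      Finset.univ
    rw [Finset.card_fin] at this
    omega
end

section
/- Let G_1, G_2, G_3 be three directed graphs on a common set of n vertices. If e(G_i) > ((52 − 4√7)/81)·n^2 + (3/2)·n for every i ∈ {1,2,3}, then there exists a rainbow transitive triangle. -/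
/-- The set of colours present on an undirected pair, as a triple of Booleans. -/
abbrev ColorSet := Bool × Bool × Bool

namespace ColorSet

/-- The number of colours in a colour set. -/
def size (a : ColorSet) : ℕ := a.1.toNat + a.2.1.toNat + a.2.2.toNat

/-- The number of colours other than the first in a colour set. -/
def tailSize (a : ColorSet) : ℕ := a.2.1.toNat + a.2.2.toNat

/-- Three edges with these colour sets do not form a rainbow triangle. -/
def Compatible (a b c : ColorSet) : Bool :=
  !(a.1 && b.2.1 && c.2.2) && !(a.1 && c.2.1 && b.2.2) && !(b.1 && a.2.1 && c.2.2) &&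
  !(b.1 && c.2.1 && a.2.2) && !(c.1 && a.2.1 && b.2.2) && !(c.1 && b.2.1 && a.2.2)

instance decidableForall {p : ColorSet → Prop} [DecidablePred p] : Decidable (∀ a, p a) :=
  decidable_of_iff (∀ x y z : Bool, p (x, y, z)) (by simp [Prod.forall])

theorem size_block_common_fst : ∀ a b : ColorSet, size a ≤ 2 → size b ≤ 2 →
    Compatible (true, true, false) a b → ∀ c d : ColorSet, size c ≤ 2 → size d ≤ 2 →
    Compatible (true, true, false) c d → Compatible (true, false, true) a c →
    Compatible (true, false, true) b d →
    size a + size b + size c + size d ≤ 5 ∧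
      (5 ≤ size a + size b + size c + size d →
        tailSize a + tailSize b + tailSize c + tailSize d ≤ 3) := by
  decide +kernel

theorem size_block_common_trd : ∀ a b : ColorSet, size a ≤ 2 → size b ≤ 2 →
    Compatible (true, false, true) a b → ∀ c d : ColorSet, size c ≤ 2 → size d ≤ 2 →
    Compatible (true, false, true) c d → Compatible (false, true, true) a c →
    Compatible (false, true, true) b d →
    size a + size b + size c + size d ≤ 5 ∧
      (5 ≤ size a + size b + size c + size d →
        ((a.2.2 && c.2.2 && (a.2.1 || c.2.1)) || (b.2.2 && d.2.2 && (b.2.1 || d.2.1)))) := by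
  decide +kernel

theorem size_star_left : ∀ a b : ColorSet, size a ≤ 2 → size b ≤ 2 →
    Compatible (true, true, false) a b →
    size a + size b ≤ 2 + ((a.1 && a.2.1).toNat + (b.1 && b.2.1).toNat) := by
  decide +kernel

theorem size_star_outer : ∀ a b : ColorSet, size a ≤ 2 → size b ≤ 2 →
    Compatible (true, false, true) a b →
    size a + size b ≤ 2 + ((a.1 && a.2.2).toNat + (b.1 && b.2.2).toNat) := by
  decide +kernel

theorem tailSize_star : ∀ e a b : ColorSet, e.1 && (e.2.1 || e.2.2) → Compatible e a b →
    tailSize a + tailSize b ≤ 2 := by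
  decide +kernel

theorem size_star_triple : ∀ a b : ColorSet, Compatible (true, true, true) a b →
    size a + size b ≤ 3 := by
  decide +kernel

theorem block_left_of_size_eq : ∀ a b : ColorSet, size a ≤ 2 → size b ≤ 2 →
    Compatible (true, true, false) a b → ∀ c d : ColorSet, size c ≤ 2 → size d ≤ 2 →
    Compatible (true, true, false) c d → Compatible (true, true, false) a c →
    Compatible (true, true, false) b d → 8 ≤ size a + size b + size c + size d →
    (a.1 && a.2.1) && (b.1 && b.2.1) && (c.1 && c.2.1) && (d.1 && d.2.1) := by
  decide +kernel

theorem block_outer_of_size_eq : ∀ a b : ColorSet, size a ≤ 2 → size b ≤ 2 →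
    Compatible (true, false, true) a b → ∀ c d : ColorSet, size c ≤ 2 → size d ≤ 2 →
    Compatible (true, false, true) c d → Compatible (true, false, true) a c →
    Compatible (true, false, true) b d → 8 ≤ size a + size b + size c + size d →
    a.1 && b.1 && c.1 && d.1 := by
  decide +kernel

end ColorSet

section Matching

variable {V : Type*} [DecidableEq V]

/-- `M` is a set of pairwise disjoint `R`-related pairs inside `U`. -/
def IsPairMatching (R : V → V → Prop) (U : Finset V) (M : Finset (V × V)) : Prop :=
  (∀ p ∈ M, p.1 ∈ U ∧ p.2 ∈ U ∧ p.1 ≠ p.2 ∧ R p.1 p.2) ∧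
    ∀ p ∈ M, ∀ q ∈ M, p ≠ q → p.1 ≠ q.1 ∧ p.1 ≠ q.2 ∧ p.2 ≠ q.1 ∧ p.2 ≠ q.2

/-- A matching of maximum cardinality. -/
def IsMaxPairMatching (R : V → V → Prop) (U : Finset V) (M : Finset (V × V)) : Prop :=
  IsPairMatching R U M ∧ ∀ M', IsPairMatching R U M' → M'.card ≤ M.card

/-- The vertices covered by a set of pairs. -/
def coveredBy (M : Finset (V × V)) : Finset V := M.biUnion fun p => {p.1, p.2}

/-- `s` and `t` are the two entries of `p`, in some order. -/
def IsEnds (p : V × V) (s t : V) : Prop := (s = p.1 ∧ t = p.2) ∨ (s = p.2 ∧ t = p.1)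

theorem mem_coveredBy {M : Finset (V × V)} {x : V} :
    x ∈ coveredBy M ↔ ∃ p ∈ M, x = p.1 ∨ x = p.2 := by
  simp [coveredBy]

variable {R : V → V → Prop} {U : Finset V} {M : Finset (V × V)}

omit [DecidableEq V] in
theorem exists_isMaxPairMatching [Fintype V] (R : V → V → Prop) (U : Finset V) :
    ∃ M, IsMaxPairMatching R U M := by
  classical
  obtain ⟨M, hM, hmax⟩ := Finset.exists_max_image
    (Finset.univ.filter (IsPairMatching R U)) Finset.card
    ⟨∅, by simp [IsPairMatching]⟩
  exact ⟨M, by simpa using hM, fun M' h => hmax M' (by simpa using h)⟩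

omit [DecidableEq V] in
theorem IsPairMatching.mono {R' : V → V → Prop} {U' : Finset V} (h : IsPairMatching R U M)
    (hR : ∀ x y, R x y → R' x y) (hU : U ⊆ U') : IsPairMatching R' U' M :=
  ⟨fun p hp => ⟨hU (h.1 p hp).1, hU (h.1 p hp).2.1, (h.1 p hp).2.2.1, hR _ _ (h.1 p hp).2.2.2⟩, h.2⟩

theorem IsPairMatching.coveredBy_subset (h : IsPairMatching R U M) : coveredBy M ⊆ U := by
  intro x hx
  obtain ⟨p, hp, rfl | rfl⟩ := mem_coveredBy.1 hx
  exacts [(h.1 p hp).1, (h.1 p hp).2.1]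

theorem IsPairMatching.sum_coveredBy (h : IsPairMatching R U M) (f : V → ℤ) :
    ∑ x ∈ coveredBy M, f x = ∑ p ∈ M, (f p.1 + f p.2) := by
  rw [coveredBy, Finset.sum_biUnion]
  · exact Finset.sum_congr rfl fun p hp => Finset.sum_pair (h.1 p hp).2.2.1
  · intro p hp q hq hpq
    have := h.2 p hp q hq hpq
    simp only [Function.onFun, Finset.disjoint_left, Finset.mem_insert, Finset.mem_singleton]
    grind

theorem IsPairMatching.card_coveredBy (h : IsPairMatching R U M) :
    ((coveredBy M).card : ℤ) = 2 * M.card := by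
  have := h.sum_coveredBy fun _ => 1
  simpa [mul_comm] using this

theorem IsPairMatching.insert (h : IsPairMatching R U M) {x y : V} (hx : x ∈ U) (hy : y ∈ U)
    (hxy : x ≠ y) (hR : R x y) (hxM : x ∉ coveredBy M) (hyM : y ∉ coveredBy M) :
    IsPairMatching R U (insert (x, y) M) ∧ (insert (x, y) M).card = M.card + 1 := by
  rw [mem_coveredBy] at hxM hyM
  push Not at hxM hyM
  refine ⟨⟨?_, ?_⟩, Finset.card_insert_of_notMem fun hm => (hxM _ hm).1 rfl⟩
  · intro p hp
    rcases Finset.mem_insert.1 hp with rfl | hp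
    exacts [⟨hx, hy, hxy, hR⟩, h.1 p hp]
  · intro p hp q hq hpq
    rcases Finset.mem_insert.1 hp with rfl | hp <;> rcases Finset.mem_insert.1 hq with rfl | hq
    · exact absurd rfl hpq
    · exact ⟨(hxM q hq).1, (hxM q hq).2, (hyM q hq).1, (hyM q hq).2⟩
    · exact ⟨(hxM p hp).1.symm, (hyM p hp).1.symm, (hxM p hp).2.symm, (hyM p hp).2.symm⟩
    · exact h.2 p hp q hq hpq

theorem mem_coveredBy_insert {x y z : V} :
    z ∈ coveredBy (insert (x, y) M) ↔ z = x ∨ z = y ∨ z ∈ coveredBy M := by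
  simp [coveredBy]

theorem IsPairMatching.erase (h : IsPairMatching R U M) (p : V × V) :
    IsPairMatching R U (M.erase p) :=
  ⟨fun q hq => h.1 q (Finset.mem_of_mem_erase hq), fun q hq r hr =>
    h.2 q (Finset.mem_of_mem_erase hq) r (Finset.mem_of_mem_erase hr)⟩

theorem IsPairMatching.mem_coveredBy_erase (h : IsPairMatching R U M) {p : V × V} (hp : p ∈ M)
    {x : V} : x ∈ coveredBy (M.erase p) ↔ x ∈ coveredBy M ∧ x ≠ p.1 ∧ x ≠ p.2 := by
  simp only [mem_coveredBy, Finset.mem_erase]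
  constructor
  · rintro ⟨q, ⟨hqp, hq⟩, hx⟩
    have := h.2 q hq p hp hqp
    grind
  · rintro ⟨⟨q, hq, hx⟩, h1, h2⟩
    exact ⟨q, ⟨by grind, hq⟩, hx⟩

theorem IsMaxPairMatching.not_rel (h : IsMaxPairMatching R U M) {x y : V}
    (hx : x ∈ U \ coveredBy M) (hy : y ∈ U \ coveredBy M) (hxy : x ≠ y) : ¬ R x y := by
  intro hR
  rw [Finset.mem_sdiff] at hx hy
  obtain ⟨h1, h2⟩ := h.1.insert hx.1 hy.1 hxy hR hx.2 hy.2
  have := h.2 _ h1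
  omega

theorem IsMaxPairMatching.not_augment_three (h : IsMaxPairMatching R U M) {p : V × V} (hp : p ∈ M)
    {s t z z' : V} (hst : IsEnds p s t) (hz : z ∈ U \ coveredBy M) (hz' : z' ∈ U \ coveredBy M)
    (hzz : z ≠ z') : ¬ (R s z ∧ R t z') := by
  rintro ⟨hs, ht⟩
  rw [Finset.mem_sdiff] at hz hz'
  have hpU := h.1.1 p hp
  have hc : p.1 ∈ coveredBy M ∧ p.2 ∈ coveredBy M :=
    ⟨mem_coveredBy.2 ⟨p, hp, .inl rfl⟩, mem_coveredBy.2 ⟨p, hp, .inr rfl⟩⟩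
  have hst' : s ∈ U ∧ t ∈ U ∧ s ≠ t ∧ s ∈ coveredBy M ∧ t ∈ coveredBy M := by
    rcases hst with ⟨rfl, rfl⟩ | ⟨rfl, rfl⟩ <;> grind
  have hst'' : ∀ x, (x ≠ p.1 ∧ x ≠ p.2) ↔ (x ≠ s ∧ x ≠ t) := by
    rcases hst with ⟨rfl, rfl⟩ | ⟨rfl, rfl⟩ <;> grind
  have hcard := Finset.card_erase_add_one hp
  have hmem : ∀ x, x ∈ coveredBy (M.erase p) ↔ x ∈ coveredBy M ∧ x ≠ s ∧ x ≠ t := by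
    intro x
    rw [h.1.mem_coveredBy_erase hp, hst'']
  clear hst'' hc hpU
  obtain ⟨h1, c1⟩ := (h.1.erase p).insert (x := s) (y := z) (by grind) (by grind) (by grind) hs
    (by grind) (by grind)
  obtain ⟨h2, c2⟩ := h1.insert (x := t) (y := z') (by grind) (by grind) (by grind) ht
    (by rw [mem_coveredBy_insert]; grind) (by rw [mem_coveredBy_insert]; grind)
  have := h.2 _ h2
  omega

theorem IsMaxPairMatching.not_augment_five (h : IsMaxPairMatching R U M) {p p' : V × V}
    (hp : p ∈ M) (hp' : p' ∈ M) (hpp : p ≠ p')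
    {s t z s' t' z' : V} (hst : IsEnds p s t) (hst' : IsEnds p' s' t')
    (hz : z ∈ U \ coveredBy M) (hz' : z' ∈ U \ coveredBy M)
    (hzz : z ≠ z') : ¬ (R s z ∧ R s' z' ∧ R t t') := by
  rintro ⟨hs, hs', ht⟩
  rw [Finset.mem_sdiff] at hz hz'
  have hpU := h.1.1 p hp
  have hpU' := h.1.1 p' hp'
  have hd := h.1.2 p hp p' hp' hpp
  have hc : p.1 ∈ coveredBy M ∧ p.2 ∈ coveredBy M :=
    ⟨mem_coveredBy.2 ⟨p, hp, .inl rfl⟩, mem_coveredBy.2 ⟨p, hp, .inr rfl⟩⟩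
  have hc' : p'.1 ∈ coveredBy M ∧ p'.2 ∈ coveredBy M :=
    ⟨mem_coveredBy.2 ⟨p', hp', .inl rfl⟩, mem_coveredBy.2 ⟨p', hp', .inr rfl⟩⟩
  have hd' : s ≠ s' ∧ s ≠ t' ∧ t ≠ s' ∧ t ≠ t' := by
    rcases hst with ⟨rfl, rfl⟩ | ⟨rfl, rfl⟩ <;> rcases hst' with ⟨rfl, rfl⟩ | ⟨rfl, rfl⟩ <;> grind
  have e1 : s ∈ U ∧ t ∈ U ∧ s ≠ t ∧ s ∈ coveredBy M ∧ t ∈ coveredBy M := by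
    rcases hst with ⟨rfl, rfl⟩ | ⟨rfl, rfl⟩ <;> grind
  have e2 : s' ∈ U ∧ t' ∈ U ∧ s' ≠ t' ∧ s' ∈ coveredBy M ∧ t' ∈ coveredBy M := by
    rcases hst' with ⟨rfl, rfl⟩ | ⟨rfl, rfl⟩ <;> grind
  have e3 : ∀ x, (x ≠ p.1 ∧ x ≠ p.2) ↔ (x ≠ s ∧ x ≠ t) := by
    rcases hst with ⟨rfl, rfl⟩ | ⟨rfl, rfl⟩ <;> grind
  have e4 : ∀ x, (x ≠ p'.1 ∧ x ≠ p'.2) ↔ (x ≠ s' ∧ x ≠ t') := by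
    rcases hst' with ⟨rfl, rfl⟩ | ⟨rfl, rfl⟩ <;> grind
  have hp'e : p' ∈ M.erase p := Finset.mem_erase.2 ⟨hpp.symm, hp'⟩
  have hcard := Finset.card_erase_add_one hp
  have hcard' := Finset.card_erase_add_one hp'e
  have hmem : ∀ x, x ∈ coveredBy ((M.erase p).erase p') ↔
      x ∈ coveredBy M ∧ (x ≠ s ∧ x ≠ t) ∧ (x ≠ s' ∧ x ≠ t') := by
    intro x
    rw [(h.1.erase p).mem_coveredBy_erase hp'e, h.1.mem_coveredBy_erase hp, e3, e4, and_assoc]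
  clear hpU hpU' hd hc hc' e3 e4
  obtain ⟨h1, c1⟩ := ((h.1.erase p).erase p').insert (x := s) (y := z) (by grind) (by grind)
    (by grind) hs (by grind) (by grind)
  obtain ⟨h2, c2⟩ := h1.insert (x := s') (y := z') (by grind) (by grind) (by grind) hs'
    (by rw [mem_coveredBy_insert]; grind) (by rw [mem_coveredBy_insert]; grind)
  obtain ⟨h3, c3⟩ := h2.insert (x := t) (y := t') (by grind) (by grind) (by grind) ht
    (by rw [mem_coveredBy_insert, mem_coveredBy_insert]; grind)
    (by rw [mem_coveredBy_insert, mem_coveredBy_insert]; grind)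
  have := h.2 _ h3
  omega

/-- Some entry of `p` is related to at least two elements of `X`. -/
def IsStar (R : V → V → Prop) (X : Finset V) (p : V × V) : Prop :=
  ∃ s t, IsEnds p s t ∧ ∃ z ∈ X, ∃ z' ∈ X, z ≠ z' ∧ R s z ∧ R s z'

theorem IsMaxPairMatching.exists_not_rel_of_isStar (h : IsMaxPairMatching R U M) {X : Finset V}
    (hX : X ⊆ U \ coveredBy M) {p p' : V × V} (hp : p ∈ M) (hp' : p' ∈ M) (hpp : p ≠ p')
    (hs : IsStar R X p) (hs' : IsStar R X p') :
    ∃ s t s' t', IsEnds p s t ∧ IsEnds p' s' t' ∧ ¬ R t t' := by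
  obtain ⟨s, t, e, z, hz, z', hz', hzz, h1, h2⟩ := hs
  obtain ⟨s', t', e', w, hw, w', hw', hww, h3, h4⟩ := hs'
  refine ⟨s, t, s', t', e, e', fun hR => ?_⟩
  by_cases hzw : z = w
  · subst hzw
    exact h.not_augment_five hp hp' hpp e e' (hX hz') (hX hw) hzz.symm ⟨h2, h3, hR⟩
  · exact h.not_augment_five hp hp' hpp e e' (hX hz) (hX hw) hzw ⟨h1, h3, hR⟩

theorem IsMaxPairMatching.sum_le_of_isStar (h : IsMaxPairMatching R U M) {X : Finset V}
    (hX : X ⊆ U \ coveredBy M) {p : V × V} (hp : p ∈ M) (hs : IsStar R X p) {f : V → ℤ}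
    (hf : ∀ z ∈ X, (¬ R p.1 z ∨ ¬ R p.2 z) → f z ≤ 1) : ∑ z ∈ X, f z ≤ X.card := by
  obtain ⟨s, t, e, z, hz, z', hz', hzz, h1, h2⟩ := hs
  have hno : ∀ w ∈ X, ¬ R t w := by
    intro w hw hR
    by_cases hzw : z = w
    · subst hzw
      exact h.not_augment_three hp e (hX hz') (hX hw) hzz.symm ⟨h2, hR⟩
    · exact h.not_augment_three hp e (hX hz) (hX hw) hzw ⟨h1, hR⟩
  have : ∑ z ∈ X, f z ≤ ∑ z ∈ X, 1 := Finset.sum_le_sum fun w hw => hf w hw (by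
    have := hno w hw
    rcases e with ⟨rfl, rfl⟩ | ⟨rfl, rfl⟩
    exacts [.inr this, .inl this])
  simpa using this

open Classical in
theorem sum_le_two_of_not_isStar {X : Finset V} {p : V × V} (hs : ¬ IsStar R X p) {f : V → ℤ}
    (hf : ∀ z ∈ X, f z ≤ (if R p.1 z then 1 else 0) + (if R p.2 z then 1 else 0)) :
    ∑ z ∈ X, f z ≤ 2 := by
  have key : ∀ s t, IsEnds p s t → (X.filter fun z => R s z).card ≤ 1 := by
    intro s t e
    rw [Finset.card_le_one]
    intro z hz z' hz'
    rw [Finset.mem_filter] at hz hz'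
    by_contra hne
    exact hs ⟨s, t, e, z, hz.1, z', hz'.1, hne, hz.2, hz'.2⟩
  have h1 := key p.1 p.2 (.inl ⟨rfl, rfl⟩)
  have h2 := key p.2 p.1 (.inr ⟨rfl, rfl⟩)
  have := Finset.sum_le_sum hf
  rw [Finset.sum_add_distrib, Finset.sum_boole, Finset.sum_boole] at this
  omega

open Classical in
theorem IsMaxPairMatching.sum_le_card_add_two (h : IsMaxPairMatching R U M) {X : Finset V}
    (hX : X ⊆ U \ coveredBy M) {p : V × V} (hp : p ∈ M) {f : V → ℤ}
    (hf : ∀ z ∈ X, f z ≤ (if R p.1 z then 1 else 0) + (if R p.2 z then 1 else 0)) :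
    ∑ z ∈ X, f z ≤ X.card + 2 := by
  by_cases hs : IsStar R X p
  · have := h.sum_le_of_isStar hX hp hs (f := f) fun z hz hn => (hf z hz).trans (by grind)
    omega
  · have := sum_le_two_of_not_isStar hs hf
    omega

end Matching

theorem total_le_of_large {τ a b c l y S G₁ G₂ : ℝ} (hτ : 9 * τ ^ 2 - 8 * τ + 1 = 0)
    (hτ₀ : 0.15 < τ) (hτ₁ : τ < 0.151) (hb : 0 ≤ b) (hc : 0 ≤ c) (hl : 0 ≤ l)
    (hy : 0 ≤ y) (hsum : a + b + c + l + y = 1) (hG₁ : 0 ≤ G₁) (hG₂ : 0 ≤ G₂)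
    (hS : S ≤ l ^ 2) (hb2 : τ ^ 2 + 2 * G₂ ≤ b ^ 2 + b * l)
    (hc2 : τ ^ 2 + 2 * G₁ ≤ c ^ 2 + c * l) (ha : (1 + 2 * τ) / 3 ≤ a) :
    a ^ 2 + S + b ^ 2 + c ^ 2 + (b + c) * l + 2 * G₁ + 2 * G₂ + y - y ^ 2 / 2 ≤
      (1 + 3 * τ ^ 2) / 2 := by
  have hβ : τ ≤ b + l / 2 := abs_le_of_sq_le_sq' (by nlinarith [sq_nonneg l]) (by positivity) |>.2
  have hγ : τ ≤ c + l / 2 := abs_le_of_sq_le_sq' (by nlinarith [sq_nonneg l]) (by positivity) |>.2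
  obtain ⟨u, rfl⟩ : ∃ u, b = u + τ - l / 2 := ⟨b + l / 2 - τ, by ring⟩
  obtain ⟨v, rfl⟩ : ∃ v, c = v + τ - l / 2 := ⟨c + l / 2 - τ, by ring⟩
  obtain ⟨p, rfl⟩ : ∃ p, a = p + (1 + 2 * τ) / 3 := ⟨a - (1 + 2 * τ) / 3, by ring⟩
  obtain ⟨K, hK⟩ : ∃ K, K = 2 * (1 - 4 * τ) / 3 := ⟨_, rfl⟩
  have hu : 0 ≤ u := by linarith
  have hv : 0 ≤ v := by linarith
  have hp : 0 ≤ p := by linarith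
  obtain ⟨w, hw⟩ : ∃ w, w = u + v := ⟨_, rfl⟩
  have hw0 : 0 ≤ w := by linarith
  have hpw : p + w ≤ K := by linarith
  have hK0 : 0 ≤ K := by linarith
  have hquad : -K ^ 2 + K * (p - w) / 2 + p ^ 2 / 2 + 3 * w ^ 2 / 2 - p * w ≤ 0 := by
    have h1 : p * p ≤ p * K := by gcongr; linarith
    have h2 : w * w ≤ w * K := by gcongr; linarith
    have h3 : K * (p + w) ≤ K * K := by gcongr
    have h4 : 0 ≤ p * w := by positivity
    linarith
  have huv : 2 * u ^ 2 + 2 * v ^ 2 ≤ 2 * w ^ 2 := by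
    have : 0 ≤ u * v := by positivity
    rw [hw]; linarith
  have hyw : y = K - p - w := by linarith
  have key : (p + (1 + 2 * τ) / 3) ^ 2 + 2 * w ^ 2 + 4 * τ * w + 2 * τ ^ 2 + y - y ^ 2 / 2 ≤
      (1 + 3 * τ ^ 2) / 2 := by
    rw [hyw]
    rw [hK] at hquad ⊢
    linarith
  have : τ * w = τ * u + τ * v := by rw [hw]; ring
  linarith

theorem total_le_of_small {τ a b c l y S G₁ G₂ : ℝ}
    (hτ₀ : 0.15 < τ) (hτ₁ : τ < 0.151) (hb : 0 ≤ b) (hc : 0 ≤ c) (hl : 0 ≤ l)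
    (hba : b ≤ a) (hca : c ≤ a)
    (hsum : a + b + c + l + y = 1)
    (hS : S ≤ l ^ 2) (hS' : S ≤ a * l) (hb2 : τ ^ 2 ≤ b ^ 2 + b * l)
    (hc2 : τ ^ 2 ≤ c ^ 2 + c * l) (ha : a ≤ (1 + 2 * τ) / 3) (hG₁ : 2 * G₁ ≤ a * b / 2)
    (hG₂ : 2 * G₂ ≤ a * c / 2) :
    a ^ 2 + S + b ^ 2 + c ^ 2 + (b + c) * l + 2 * G₁ + 2 * G₂ + y - y ^ 2 / 2 ≤
      (1 + 3 * τ ^ 2) / 2 := by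
  wlog hbc : c ≤ b generalizing b c G₁ G₂
  · have := this hc hb hca hba (by linarith) hc2 hb2 hG₂ hG₁ (by linarith)
    linarith
  have hγ : τ ≤ c + l / 2 := abs_le_of_sq_le_sq' (by nlinarith [sq_nonneg l]) (by positivity) |>.2
  have hy : y = 1 - (a + b + c + l) := by linarith
  have ha0 : 0 ≤ a := hb.trans hba
  suffices a ^ 2 - a * (b + c) + (b - c) ^ 2 + 2 * S - l ^ 2 - 2 * a * l ≤ 3 * τ ^ 2 by
    subst hy; linarith
  rcases le_total a l with hal | hal
  · have h1 : a * a ≤ l * l := by gcongr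
    have h2 : b * b ≤ a * b := by gcongr
    have h3 : c * c ≤ b * c := by gcongr
    have h4 : 0 ≤ a * c := by positivity
    have h5 : 0 ≤ b * c := by positivity
    have h6 := sq_nonneg τ
    linarith
  have h1 : (b - c) * (b - c) ≤ (b - c) * (a - c) :=
    mul_le_mul_of_nonneg_left (by linarith) (by linarith)
  have h2 : c * c ≤ c * b := by gcongr
  have h3 : a * τ ≤ a * (c + l / 2) := by gcongr
  have h4 : l * l ≤ a * l := by gcongr
  have h5 : a * (a - 2 * τ) ≤ 3 * τ ^ 2 := by nlinarith
  linarith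

section RainbowFree

variable {V : Type*}

/-- Three symmetric irreflexive relations without a rainbow triangle. -/
structure IsRainbowFree (g₁ g₂ g₃ : V → V → Bool) : Prop where
  symm₁ : ∀ x y, g₁ x y = g₁ y x
  symm₂ : ∀ x y, g₂ x y = g₂ y x
  symm₃ : ∀ x y, g₃ x y = g₃ y x
  irrefl₁ : ∀ x, g₁ x x = false
  irrefl₂ : ∀ x, g₂ x x = false
  irrefl₃ : ∀ x, g₃ x x = false
  free : ∀ x y z, ¬ (g₁ x y = true ∧ g₂ y z = true ∧ g₃ x z = true)

/-- The set of colours on the pair `x, y`. -/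
def edgeColors (g₁ g₂ g₃ : V → V → Bool) (x y : V) : ColorSet := (g₁ x y, g₂ x y, g₃ x y)

/-- The number of colours on the pair `x, y`, minus one. -/
def totalExcess (g₁ g₂ g₃ : V → V → Bool) (x y : V) : ℤ :=
  ((edgeColors g₁ g₂ g₃ x y).size : ℤ) - 1

/-- The number of colours other than the first on the pair `x, y`, minus one. -/
def tailExcess (g₁ g₂ g₃ : V → V → Bool) (x y : V) : ℤ :=
  ((edgeColors g₁ g₂ g₃ x y).tailSize : ℤ) - 1

variable {g₁ g₂ g₃ : V → V → Bool}

theorem IsRainbowFree.swap_left (h : IsRainbowFree g₁ g₂ g₃) : IsRainbowFree g₂ g₁ g₃ :=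
  ⟨h.symm₂, h.symm₁, h.symm₃, h.irrefl₂, h.irrefl₁, h.irrefl₃, fun x y z ⟨a, b, c⟩ =>
    h.free z y x ⟨h.symm₁ z y ▸ b, h.symm₂ y x ▸ a, h.symm₃ z x ▸ c⟩⟩

theorem IsRainbowFree.swap_right (h : IsRainbowFree g₁ g₂ g₃) : IsRainbowFree g₁ g₃ g₂ :=
  ⟨h.symm₁, h.symm₃, h.symm₂, h.irrefl₁, h.irrefl₃, h.irrefl₂, fun x y z ⟨a, b, c⟩ =>
    h.free y x z ⟨h.symm₁ y x ▸ a, c, b⟩⟩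

theorem edgeColors_comm (h : IsRainbowFree g₁ g₂ g₃) (x y : V) :
    edgeColors g₁ g₂ g₃ x y = edgeColors g₁ g₂ g₃ y x := by
  rw [edgeColors, edgeColors, h.symm₁, h.symm₂, h.symm₃]

theorem totalExcess_comm (h : IsRainbowFree g₁ g₂ g₃) (x y : V) :
    totalExcess g₁ g₂ g₃ x y = totalExcess g₁ g₂ g₃ y x := by
  rw [totalExcess, totalExcess, edgeColors_comm h]

theorem tailExcess_comm (h : IsRainbowFree g₁ g₂ g₃) (x y : V) :
    tailExcess g₁ g₂ g₃ x y = tailExcess g₁ g₂ g₃ y x := by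
  rw [tailExcess, tailExcess, edgeColors_comm h]

theorem totalExcess_swap_left : totalExcess g₂ g₁ g₃ = totalExcess g₁ g₂ g₃ := by
  ext x y
  simp only [totalExcess, edgeColors, ColorSet.size]
  push_cast
  ring

theorem IsRainbowFree.compatible (h : IsRainbowFree g₁ g₂ g₃) (x y z : V) :
    ColorSet.Compatible (edgeColors g₁ g₂ g₃ x y) (edgeColors g₁ g₂ g₃ x z)
      (edgeColors g₁ g₂ g₃ y z) = true := by
  have h1 := h.free y x z
  have h2 := h.free x y z
  have h3 := h.free x z y
  have h4 := h.free z x y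
  have h5 := h.free y z x
  have h6 := h.free z y x
  rw [h.symm₁ y x] at h1
  rw [h.symm₂ z y] at h3
  rw [h.symm₁ z x, h.symm₃ z y] at h4
  rw [h.symm₂ z x, h.symm₃ y x] at h5
  rw [h.symm₁ z y, h.symm₂ y x, h.symm₃ z x] at h6
  simp only [ColorSet.Compatible, edgeColors]
  grind

/-- The sum of `f` over the edges between two pairs. -/
def blockSum (f : V → V → ℤ) (p q : V × V) : ℤ := f p.1 q.1 + f p.2 q.1 + f p.1 q.2 + f p.2 q.2

theorem blockSum_comm {f : V → V → ℤ} (hf : ∀ x y, f x y = f y x) (p q : V × V) :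
    blockSum f p q = blockSum f q p := by
  rw [blockSum, blockSum, hf p.1 q.1, hf p.2 q.1, hf p.1 q.2, hf p.2 q.2]; ring

/-- The sum of `f` over a combinatorial rectangle. -/
def boxSum (f : V → V → ℤ) (X Y : Finset V) : ℤ := ∑ x ∈ X, ∑ y ∈ Y, f x y

theorem boxSum_comm {f : V → V → ℤ} (hf : ∀ x y, f x y = f y x) (X Y : Finset V) :
    boxSum f X Y = boxSum f Y X := by
  rw [boxSum, boxSum, Finset.sum_comm]
  exact Finset.sum_congr rfl fun x _ => Finset.sum_congr rfl fun y _ => hf y x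

/-- The number of pairs `p ∈ P`, `q ∈ Q` between which `f` has positive sum. -/
def gainCount (f : V → V → ℤ) (P Q : Finset (V × V)) : ℤ :=
  ∑ p ∈ P, ∑ q ∈ Q, if 1 ≤ blockSum f p q then 1 else 0

/-- The number of ordered pairs from `P` having a common `q ∈ Q` with which both have positive
sum. -/
def commonGainCount (f : V → V → ℤ) (P Q : Finset (V × V)) : ℤ :=
  ∑ p ∈ P, ∑ p' ∈ P,
    if ∃ q ∈ Q, 1 ≤ blockSum f p q ∧ 1 ≤ blockSum f p' q then 1 else 0

theorem gainCount_nonneg (f : V → V → ℤ) (P Q : Finset (V × V)) : 0 ≤ gainCount f P Q :=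
  Finset.sum_nonneg fun _ _ => Finset.sum_nonneg fun _ _ => by split_ifs <;> simp

theorem gainCount_le (f : V → V → ℤ) (P Q : Finset (V × V)) :
    gainCount f P Q ≤ P.card * Q.card := by
  have : gainCount f P Q ≤ ∑ p ∈ P, ∑ q ∈ Q, 1 :=
    Finset.sum_le_sum fun _ _ => Finset.sum_le_sum fun _ _ => by split_ifs <;> simp
  simpa using this

theorem sum_div_le_sum_common {α β : Type*} (P : Finset α) (Q : Finset β) (r : α → β → Prop)
    [∀ p q, Decidable (r p q)] :
    ∑ p ∈ P, ∑ q ∈ Q, (if r p q then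
        ((P.filter fun p => r p q).card : ℝ) / ((Q.filter fun q => r p q).card : ℝ) else 0) ≤
      ∑ p ∈ P, ∑ p' ∈ P, if ∃ q ∈ Q, r p q ∧ r p' q then (1 : ℝ) else 0 := by
  refine Finset.sum_le_sum fun p _ => ?_
  rw [← Finset.sum_filter, ← Finset.sum_div, Finset.sum_boole]
  refine div_le_of_le_mul₀ (by positivity) (by positivity) ?_
  rw [mul_comm, ← nsmul_eq_mul]
  refine Finset.sum_le_card_nsmul _ _ _ fun q hq => ?_
  rw [Finset.mem_filter] at hq
  exact_mod_cast Finset.card_le_card fun p' hp' => by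
    rw [Finset.mem_filter] at hp' ⊢
    exact ⟨hp'.1, q, hq.1, hq.2, hp'.2⟩

theorem two_mul_gainCount_le {f : V → V → ℤ} (hf : ∀ x y, f x y = f y x) (P Q : Finset (V × V)) :
    2 * gainCount f P Q ≤ commonGainCount f P Q + commonGainCount f Q P := by
  have h1 := sum_div_le_sum_common P Q fun p q => 1 ≤ blockSum f p q
  have h2 := sum_div_le_sum_common Q P fun q p => 1 ≤ blockSum f p q
  have e : commonGainCount f Q P = ∑ q ∈ Q, ∑ q' ∈ Q,
      if ∃ p ∈ P, 1 ≤ blockSum f p q ∧ 1 ≤ blockSum f p q' then 1 else 0 :=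
    Finset.sum_congr rfl fun q _ => Finset.sum_congr rfl fun q' _ => by
      simp_rw [blockSum_comm hf q, blockSum_comm hf q']
  rw [Finset.sum_comm] at h2
  have h3 : (2 * gainCount f P Q : ℝ) ≤ commonGainCount f P Q + commonGainCount f Q P := by
    rw [e, commonGainCount, gainCount]
    push_cast
    refine le_trans ?_ (add_le_add h1 h2)
    rw [Finset.mul_sum, ← Finset.sum_add_distrib]
    refine Finset.sum_le_sum fun p hp => ?_
    rw [Finset.mul_sum, ← Finset.sum_add_distrib]
    refine Finset.sum_le_sum fun q hq => ?_
    split_ifs with hpq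
    · have c1 : 0 < (P.filter fun p => 1 ≤ blockSum f p q).card :=
        Finset.card_pos.2 ⟨p, Finset.mem_filter.2 ⟨hp, hpq⟩⟩
      have c2 : 0 < (Q.filter fun q => 1 ≤ blockSum f p q).card :=
        Finset.card_pos.2 ⟨q, Finset.mem_filter.2 ⟨hq, hpq⟩⟩
      generalize (P.filter fun p => 1 ≤ blockSum f p q).card = m at c1 ⊢
      generalize (Q.filter fun q => 1 ≤ blockSum f p q).card = n at c2 ⊢
      have c1' : (0 : ℝ) < m := by exact_mod_cast c1
      have c2' : (0 : ℝ) < n := by exact_mod_cast c2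
      rw [div_add_div _ _ c2'.ne' c1'.ne', le_div_iff₀ (by positivity)]
      nlinarith [sq_nonneg ((m : ℝ) - n)]
    · simp
  exact_mod_cast h3

end RainbowFree

section Decomposition

variable {V : Type*} [DecidableEq V]

/-- Both relations hold. -/
def Both (g g' : V → V → Bool) (x y : V) : Prop := g x y = true ∧ g' x y = true

omit [DecidableEq V] in
theorem both_comm (g g' : V → V → Bool) : Both g g' = Both g' g := by
  ext x y
  exact and_comm

/-- The vertex set is split into a matching `T` of edges with all three colours outside `U`, and,
inside `U` (which has no such edges), successive maximum matchings `A`, `B`, `C` of edges with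
colours `{1, 2}`, `{1, 3}`, `{2, 3}`, together with a remainder `L`. -/
structure IsDecomposition [Fintype V] (g₁ g₂ g₃ : V → V → Bool) (T A B C : Finset (V × V))
    (U L : Finset V) : Prop where
  rainbowFree : IsRainbowFree g₁ g₂ g₃
  size_le : ∀ x ∈ U, ∀ y ∈ U, (edgeColors g₁ g₂ g₃ x y).size ≤ 2
  size_le_one : ∀ x ∈ L, ∀ y ∈ L, (edgeColors g₁ g₂ g₃ x y).size ≤ 1
  sum_eq : ∀ f : V → ℤ, ∑ x, f x = ∑ x ∈ coveredBy T, f x + ∑ x ∈ coveredBy A, f x +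
    ∑ x ∈ coveredBy B, f x + ∑ x ∈ coveredBy C, f x + ∑ x ∈ L, f x
  matching : IsPairMatching (fun x y => g₁ x y = true ∧ g₂ x y = true ∧ g₃ x y = true)
    Finset.univ T
  max_A : ∃ W ⊆ U, IsMaxPairMatching (Both g₁ g₂) W A ∧ L ⊆ W \ coveredBy A
  max_B : ∃ W ⊆ U, IsMaxPairMatching (Both g₁ g₃) W B ∧ L ⊆ W \ coveredBy B
  max_C : ∃ W ⊆ U, IsMaxPairMatching (Both g₂ g₃) W C ∧ L ⊆ W \ coveredBy C

theorem IsPairMatching.boxSum_coveredBy_left {R : V → V → Prop} {W : Finset V}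
    {M : Finset (V × V)} (h : IsPairMatching R W M) (f : V → V → ℤ) (X : Finset V) :
    boxSum f (coveredBy M) X = ∑ p ∈ M, ∑ z ∈ X, (f p.1 z + f p.2 z) := by
  rw [boxSum, h.sum_coveredBy]
  simp only [Finset.sum_add_distrib]

theorem IsPairMatching.boxSum_coveredBy {R R' : V → V → Prop} {W W' : Finset V}
    {M M' : Finset (V × V)} (h : IsPairMatching R W M) (h' : IsPairMatching R' W' M')
    (f : V → V → ℤ) :
    boxSum f (coveredBy M) (coveredBy M') = ∑ p ∈ M, ∑ q ∈ M', blockSum f p q := by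
  rw [h.boxSum_coveredBy_left]
  refine Finset.sum_congr rfl fun p _ => ?_
  rw [h'.sum_coveredBy]
  exact Finset.sum_congr rfl fun q _ => by rw [blockSum]; ring

omit [DecidableEq V] in
theorem ite_both {g g' : V → V → Bool} {x z : V} [Decidable (Both g g' x z)] :
    (if Both g g' x z then (1 : ℤ) else 0) = ((g x z && g' x z).toNat : ℤ) := by
  by_cases h : Both g g' x z
  · rw [if_pos h, h.1, h.2]; rfl
  · rw [if_neg h]
    rw [Both, ← Bool.and_eq_true] at h
    simp [h]

omit [DecidableEq V] in
theorem tailExcess_le (g₁ g₂ g₃ : V → V → Bool) (x y : V) : tailExcess g₁ g₂ g₃ x y ≤ 1 := by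
  have h1 := Bool.toNat_le (g₂ x y)
  have h2 := Bool.toNat_le (g₃ x y)
  simp only [tailExcess, edgeColors, ColorSet.tailSize]
  omega

namespace IsDecomposition

variable [Fintype V] {g₁ g₂ g₃ : V → V → Bool} {T A B C : Finset (V × V)} {U L : Finset V}

theorem swap (hd : IsDecomposition g₁ g₂ g₃ T A B C U L) :
    IsDecomposition g₂ g₁ g₃ T A C B U L where
  rainbowFree := hd.rainbowFree.swap_left
  size_le x hx y hy := by
    have := hd.size_le x hx y hy
    simp only [edgeColors, ColorSet.size] at this ⊢
    omega
  size_le_one x hx y hy := by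
    have := hd.size_le_one x hx y hy
    simp only [edgeColors, ColorSet.size] at this ⊢
    omega
  sum_eq f := by rw [hd.sum_eq]; ring
  matching := hd.matching.mono (fun _ _ h => ⟨h.2.1, h.1, h.2.2⟩) subset_rfl
  max_A := both_comm g₁ g₂ ▸ hd.max_A
  max_B := hd.max_C
  max_C := hd.max_B

theorem subset (hd : IsDecomposition g₁ g₂ g₃ T A B C U L) : L ⊆ U := by
  obtain ⟨W, hW, -, hL⟩ := hd.max_A
  exact hL.trans (Finset.sdiff_subset.trans hW)

theorem edge_A (hd : IsDecomposition g₁ g₂ g₃ T A B C U L) {p : V × V} (hp : p ∈ A) :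
    p.1 ∈ U ∧ p.2 ∈ U ∧ edgeColors g₁ g₂ g₃ p.1 p.2 = (true, true, false) := by
  obtain ⟨W, hW, hM, -⟩ := hd.max_A
  obtain ⟨h1, h2, -, h3, h4⟩ := hM.1.1 p hp
  have := hd.size_le _ (hW h1) _ (hW h2)
  refine ⟨hW h1, hW h2, ?_⟩
  simp only [edgeColors, ColorSet.size, h3, h4] at this ⊢
  cases h : g₃ p.1 p.2 <;> simp_all

theorem edge_B (hd : IsDecomposition g₁ g₂ g₃ T A B C U L) {p : V × V} (hp : p ∈ B) :
    p.1 ∈ U ∧ p.2 ∈ U ∧ edgeColors g₁ g₂ g₃ p.1 p.2 = (true, false, true) := by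
  obtain ⟨W, hW, hM, -⟩ := hd.max_B
  obtain ⟨h1, h2, -, h3, h4⟩ := hM.1.1 p hp
  have := hd.size_le _ (hW h1) _ (hW h2)
  refine ⟨hW h1, hW h2, ?_⟩
  simp only [edgeColors, ColorSet.size, h3, h4] at this ⊢
  cases h : g₂ p.1 p.2 <;> simp_all

theorem edge_C (hd : IsDecomposition g₁ g₂ g₃ T A B C U L) {p : V × V} (hp : p ∈ C) :
    p.1 ∈ U ∧ p.2 ∈ U ∧ edgeColors g₁ g₂ g₃ p.1 p.2 = (false, true, true) := by
  obtain ⟨h1, h2, h3⟩ := hd.swap.edge_B hp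
  refine ⟨h1, h2, ?_⟩
  simp only [edgeColors, Prod.mk.injEq] at h3 ⊢
  exact ⟨h3.2.1, h3.1, h3.2.2⟩

theorem boxSum_univ (hd : IsDecomposition g₁ g₂ g₃ T A B C U L) {f : V → V → ℤ}
    (hf : ∀ x y, f x y = f y x) :
    boxSum f Finset.univ Finset.univ =
      boxSum f (coveredBy T) (coveredBy T) + boxSum f (coveredBy A) (coveredBy A) +
      boxSum f (coveredBy B) (coveredBy B) + boxSum f (coveredBy C) (coveredBy C) +
      boxSum f L L +
      2 * (boxSum f (coveredBy T) (coveredBy A) + boxSum f (coveredBy T) (coveredBy B) +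
        boxSum f (coveredBy T) (coveredBy C) + boxSum f (coveredBy T) L +
        boxSum f (coveredBy A) (coveredBy B) + boxSum f (coveredBy A) (coveredBy C) +
        boxSum f (coveredBy A) L + boxSum f (coveredBy B) (coveredBy C) +
        boxSum f (coveredBy B) L + boxSum f (coveredBy C) L) := by
  have h : ∀ X, boxSum f X Finset.univ = boxSum f X (coveredBy T) + boxSum f X (coveredBy A) +
      boxSum f X (coveredBy B) + boxSum f X (coveredBy C) + boxSum f X L := by
    intro X
    simp only [boxSum, hd.sum_eq, Finset.sum_add_distrib]
  have h' : boxSum f Finset.univ Finset.univ = boxSum f (coveredBy T) Finset.univ +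
      boxSum f (coveredBy A) Finset.univ + boxSum f (coveredBy B) Finset.univ +
      boxSum f (coveredBy C) Finset.univ + boxSum f L Finset.univ := hd.sum_eq _
  rw [h', h, h, h, h, h, boxSum_comm hf (coveredBy A) (coveredBy T),
    boxSum_comm hf (coveredBy B) (coveredBy T), boxSum_comm hf (coveredBy C) (coveredBy T),
    boxSum_comm hf L (coveredBy T), boxSum_comm hf (coveredBy B) (coveredBy A),
    boxSum_comm hf (coveredBy C) (coveredBy A), boxSum_comm hf L (coveredBy A),
    boxSum_comm hf (coveredBy C) (coveredBy B), boxSum_comm hf L (coveredBy B),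
    boxSum_comm hf L (coveredBy C)]
  ring

theorem totalExcess_le (hd : IsDecomposition g₁ g₂ g₃ T A B C U L) {x y : V} (hx : x ∈ U)
    (hy : y ∈ U) : totalExcess g₁ g₂ g₃ x y ≤ 1 := by
  have := hd.size_le x hx y hy
  rw [totalExcess]; omega

theorem block_A_B (hd : IsDecomposition g₁ g₂ g₃ T A B C U L) {p q : V × V} (hp : p ∈ A)
    (hq : q ∈ B) : blockSum (totalExcess g₁ g₂ g₃) p q ≤ 1 ∧
      (1 ≤ blockSum (totalExcess g₁ g₂ g₃) p q → blockSum (tailExcess g₁ g₂ g₃) p q ≤ -1) := by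
  obtain ⟨p1, p2, hp⟩ := hd.edge_A hp
  obtain ⟨q1, q2, hq⟩ := hd.edge_B hq
  have hc := hd.rainbowFree.compatible
  have he := edgeColors_comm hd.rainbowFree
  have := ColorSet.size_block_common_fst _ _ (hd.size_le _ p1 _ q1) (hd.size_le _ p2 _ q1)
    (hp ▸ hc p.1 p.2 q.1) _ _ (hd.size_le _ p1 _ q2) (hd.size_le _ p2 _ q2)
    (hp ▸ hc p.1 p.2 q.2) (by simpa [hq, he] using hc q.1 q.2 p.1) (by simpa [hq, he] using hc q.1 q.2 p.2)
  simp only [blockSum, totalExcess, tailExcess]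
  omega

theorem block_B_C (hd : IsDecomposition g₁ g₂ g₃ T A B C U L) {p q : V × V} (hp : p ∈ B)
    (hq : q ∈ C) : blockSum (totalExcess g₁ g₂ g₃) p q ≤ 1 ∧
      (1 ≤ blockSum (totalExcess g₁ g₂ g₃) p q → ∃ t, (t = p.1 ∨ t = p.2) ∧
        g₃ t q.1 ∧ g₃ t q.2 ∧ (g₂ t q.1 ∨ g₂ t q.2)) := by
  obtain ⟨p1, p2, hp⟩ := hd.edge_B hp
  obtain ⟨q1, q2, hq⟩ := hd.edge_C hq
  have hc := hd.rainbowFree.compatible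
  have he := edgeColors_comm hd.rainbowFree
  obtain ⟨h1, h2⟩ := ColorSet.size_block_common_trd _ _ (hd.size_le _ p1 _ q1)
    (hd.size_le _ p2 _ q1) (hp ▸ hc p.1 p.2 q.1) _ _ (hd.size_le _ p1 _ q2)
    (hd.size_le _ p2 _ q2) (hp ▸ hc p.1 p.2 q.2) (by simpa [hq, he] using hc q.1 q.2 p.1)
    (by simpa [hq, he] using hc q.1 q.2 p.2)
  simp only [blockSum, totalExcess]
  refine ⟨by omega, fun h => ?_⟩
  have := h2 (by omega)
  simp only [edgeColors, Bool.or_eq_true, Bool.and_eq_true] at this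
  rcases this with h | h
  · exact ⟨p.1, .inl rfl, h.1.1, h.1.2, h.2⟩
  · exact ⟨p.2, .inr rfl, h.1.1, h.1.2, h.2⟩

theorem block_A_A (hd : IsDecomposition g₁ g₂ g₃ T A B C U L) {p q : V × V} (hp : p ∈ A)
    (hq : q ∈ A) (h : ∃ s t, (s = p.1 ∨ s = p.2) ∧ (t = q.1 ∨ t = q.2) ∧ ¬ Both g₁ g₂ s t) :
    blockSum (totalExcess g₁ g₂ g₃) p q ≤ 3 := by
  obtain ⟨p1, p2, hp⟩ := hd.edge_A hp
  obtain ⟨q1, q2, hq⟩ := hd.edge_A hq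
  have hc := hd.rainbowFree.compatible
  have he := edgeColors_comm hd.rainbowFree
  have := ColorSet.block_left_of_size_eq _ _ (hd.size_le _ p1 _ q1)
    (hd.size_le _ p2 _ q1) (hp ▸ hc p.1 p.2 q.1) _ _ (hd.size_le _ p1 _ q2)
    (hd.size_le _ p2 _ q2) (hp ▸ hc p.1 p.2 q.2) (by simpa [hq, he] using hc q.1 q.2 p.1)
    (by simpa [hq, he] using hc q.1 q.2 p.2)
  simp only [blockSum, totalExcess]
  by_contra hlt
  have := this (by omega)
  simp only [edgeColors, Bool.and_eq_true] at this
  obtain ⟨s, t, rfl | rfl, rfl | rfl, h⟩ := h <;> exact h (by unfold Both; tauto)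

theorem block_B_B (hd : IsDecomposition g₁ g₂ g₃ T A B C U L) {p q : V × V} (hp : p ∈ B)
    (hq : q ∈ B) (h : ∃ s t, (s = p.1 ∨ s = p.2) ∧ (t = q.1 ∨ t = q.2) ∧ ¬ g₁ s t) :
    blockSum (totalExcess g₁ g₂ g₃) p q ≤ 3 := by
  obtain ⟨p1, p2, hp⟩ := hd.edge_B hp
  obtain ⟨q1, q2, hq⟩ := hd.edge_B hq
  have hc := hd.rainbowFree.compatible
  have he := edgeColors_comm hd.rainbowFree
  have := ColorSet.block_outer_of_size_eq _ _ (hd.size_le _ p1 _ q1)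
    (hd.size_le _ p2 _ q1) (hp ▸ hc p.1 p.2 q.1) _ _ (hd.size_le _ p1 _ q2)
    (hd.size_le _ p2 _ q2) (hp ▸ hc p.1 p.2 q.2) (by simpa [hq, he] using hc q.1 q.2 p.1)
    (by simpa [hq, he] using hc q.1 q.2 p.2)
  simp only [blockSum, totalExcess]
  by_contra hlt
  have := this (by omega)
  simp only [edgeColors, Bool.and_eq_true] at this
  obtain ⟨s, t, rfl | rfl, rfl | rfl, h⟩ := h <;> exact h (by tauto)

theorem blockSum_le (hd : IsDecomposition g₁ g₂ g₃ T A B C U L) {p q : V × V} (p1 : p.1 ∈ U)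
    (p2 : p.2 ∈ U) (q1 : q.1 ∈ U) (q2 : q.2 ∈ U) : blockSum (totalExcess g₁ g₂ g₃) p q ≤ 4 := by
  have h1 := hd.totalExcess_le p1 q1
  have h2 := hd.totalExcess_le p2 q1
  have h3 := hd.totalExcess_le p1 q2
  have h4 := hd.totalExcess_le p2 q2
  rw [blockSum]; omega

theorem totalExcess_self (hd : IsDecomposition g₁ g₂ g₃ T A B C U L) (x : V) :
    totalExcess g₁ g₂ g₃ x x = -1 := by
  have h := hd.rainbowFree
  simp [totalExcess, edgeColors, ColorSet.size, h.irrefl₁, h.irrefl₂, h.irrefl₃]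

theorem blockSum_self_le (hd : IsDecomposition g₁ g₂ g₃ T A B C U L) {p : V × V} (p1 : p.1 ∈ U)
    (p2 : p.2 ∈ U) : blockSum (totalExcess g₁ g₂ g₃) p p ≤ 3 := by
  have h2 := hd.totalExcess_le p2 p1
  have h3 := hd.totalExcess_le p1 p2
  rw [blockSum, hd.totalExcess_self, hd.totalExcess_self]; omega

theorem boxSum_A_A_add_two_mul_boxSum_A_L (hd : IsDecomposition g₁ g₂ g₃ T A B C U L) :
    ∃ σ : ℤ, 0 ≤ σ ∧ σ ≤ A.card ∧
      boxSum (totalExcess g₁ g₂ g₃) (coveredBy A) (coveredBy A) +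
        2 * boxSum (totalExcess g₁ g₂ g₃) (coveredBy A) L ≤
      4 * A.card ^ 2 - σ ^ 2 + 2 * σ * L.card + 4 * A.card := by
  classical
  obtain ⟨W, hW, hM, hL⟩ := hd.max_A
  refine ⟨(A.filter (IsStar (Both g₁ g₂) L)).card, by positivity,
    by exact_mod_cast Finset.card_filter_le _ _, ?_⟩
  have h1 : boxSum (totalExcess g₁ g₂ g₃) (coveredBy A) (coveredBy A) ≤ ∑ p ∈ A, ∑ q ∈ A,
      (4 - (if IsStar (Both g₁ g₂) L p then 1 else 0) *
        (if IsStar (Both g₁ g₂) L q then 1 else 0)) := by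
    rw [hM.1.boxSum_coveredBy hM.1]
    refine Finset.sum_le_sum fun p hp => Finset.sum_le_sum fun q hq => ?_
    obtain ⟨p1, p2, -⟩ := hd.edge_A hp
    obtain ⟨q1, q2, -⟩ := hd.edge_A hq
    have h4 := hd.blockSum_le p1 p2 q1 q2
    by_cases hs : IsStar (Both g₁ g₂) L p ∧ IsStar (Both g₁ g₂) L q
    · rw [if_pos hs.1, if_pos hs.2]
      by_cases hpq : p = q
      · subst hpq
        exact hd.blockSum_self_le p1 p2
      · obtain ⟨s, t, s', t', e, e', hn⟩ := hM.exists_not_rel_of_isStar hL hp hq hpq hs.1 hs.2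
        refine hd.block_A_A hp hq ⟨t, t', ?_, ?_, hn⟩
        · rcases e with e | e <;> simp [e.2]
        · rcases e' with e | e <;> simp [e.2]
    · split_ifs <;> simp_all
  have h2 : boxSum (totalExcess g₁ g₂ g₃) (coveredBy A) L ≤
      ∑ p ∈ A, (2 + if IsStar (Both g₁ g₂) L p then (L.card : ℤ) else 0) := by
    rw [hM.1.boxSum_coveredBy_left]
    refine Finset.sum_le_sum fun p hp => ?_
    obtain ⟨p1, p2, he⟩ := hd.edge_A hp
    have hf : ∀ z ∈ L, totalExcess g₁ g₂ g₃ p.1 z + totalExcess g₁ g₂ g₃ p.2 z ≤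
        (if Both g₁ g₂ p.1 z then 1 else 0) + (if Both g₁ g₂ p.2 z then 1 else 0) := by
      intro z hz
      have hzU := hd.subset hz
      have := ColorSet.size_star_left _ _ (hd.size_le _ p1 _ hzU) (hd.size_le _ p2 _ hzU)
        (he ▸ hd.rainbowFree.compatible p.1 p.2 z)
      rw [ite_both, ite_both]
      simp only [totalExcess, edgeColors] at this ⊢
      omega
    split_ifs with hs
    · have := hM.sum_le_of_isStar hL hp hs fun z hz hn => (hf z hz).trans (by grind)
      omega
    · simpa using sum_le_two_of_not_isStar hs hf
  have e1 : ∑ p ∈ A, ∑ q ∈ A, ((4 : ℤ) - (if IsStar (Both g₁ g₂) L p then 1 else 0) *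
        (if IsStar (Both g₁ g₂) L q then 1 else 0)) =
      4 * A.card ^ 2 - (A.filter (IsStar (Both g₁ g₂) L)).card ^ 2 := by
    simp only [Finset.sum_sub_distrib, ← Finset.mul_sum, ← Finset.sum_mul, Finset.sum_boole,
      Finset.sum_const, nsmul_eq_mul]
    ring
  have e2 : ∑ p ∈ A, (2 + if IsStar (Both g₁ g₂) L p then (L.card : ℤ) else 0) =
      2 * A.card + (A.filter (IsStar (Both g₁ g₂) L)).card * L.card := by
    rw [Finset.sum_add_distrib, ← Finset.sum_filter]
    simp [mul_comm]
  rw [e1] at h1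
  rw [e2] at h2
  linarith

theorem boxSum_B_B_le (hd : IsDecomposition g₁ g₂ g₃ T A B C U L) :
    boxSum (totalExcess g₁ g₂ g₃) (coveredBy B) (coveredBy B) ≤
      4 * B.card ^ 2 - commonGainCount (totalExcess g₁ g₂ g₃) B C := by
  obtain ⟨W, hW, hM, hL⟩ := hd.max_B
  have e : (4 : ℤ) * B.card ^ 2 = ∑ p ∈ B, ∑ q ∈ B, 4 := by simp; ring
  rw [hM.1.boxSum_coveredBy hM.1, e, commonGainCount, ← Finset.sum_sub_distrib]
  refine Finset.sum_le_sum fun p hp => ?_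
  rw [← Finset.sum_sub_distrib]
  refine Finset.sum_le_sum fun q hq => ?_
  obtain ⟨p1, p2, -⟩ := hd.edge_B hp
  obtain ⟨q1, q2, -⟩ := hd.edge_B hq
  split_ifs with h
  · by_cases hpq : p = q
    · subst hpq
      exact hd.blockSum_self_le p1 p2
    obtain ⟨r, hr, h1, h2⟩ := h
    obtain ⟨s, hs, h3, h4, h5⟩ := (hd.block_B_C hp hr).2 h1
    obtain ⟨t, ht, h6, h7, -⟩ := (hd.block_B_C hq hr).2 h2
    refine hd.block_B_B hp hq ⟨s, t, hs, ht, fun h8 => ?_⟩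
    rw [hd.rainbowFree.symm₁] at h8
    rcases h5 with h5 | h5
    exacts [hd.rainbowFree.free _ _ _ ⟨h8, h5, h6⟩, hd.rainbowFree.free _ _ _ ⟨h8, h5, h7⟩]
  · simpa using hd.blockSum_le p1 p2 q1 q2

theorem boxSum_B_L_le (hd : IsDecomposition g₁ g₂ g₃ T A B C U L) :
    boxSum (totalExcess g₁ g₂ g₃) (coveredBy B) L ≤ B.card * (L.card + 2) := by
  classical
  obtain ⟨W, hW, hM, hL⟩ := hd.max_B
  rw [hM.1.boxSum_coveredBy_left, ← nsmul_eq_mul]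
  refine Finset.sum_le_card_nsmul _ _ _ fun p hp => hM.sum_le_card_add_two hL hp fun z hz => ?_
  obtain ⟨p1, p2, he⟩ := hd.edge_B hp
  have hzU := hd.subset hz
  have := ColorSet.size_star_outer _ _ (hd.size_le _ p1 _ hzU) (hd.size_le _ p2 _ hzU)
    (he ▸ hd.rainbowFree.compatible p.1 p.2 z)
  rw [ite_both, ite_both]
  simp only [totalExcess, edgeColors] at this ⊢
  omega

theorem boxSum_tailExcess_C_L_le (hd : IsDecomposition g₁ g₂ g₃ T A B C U L) :
    boxSum (tailExcess g₁ g₂ g₃) (coveredBy C) L ≤ C.card * (L.card + 2) := by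
  classical
  obtain ⟨W, hW, hM, hL⟩ := hd.max_C
  rw [hM.1.boxSum_coveredBy_left, ← nsmul_eq_mul]
  refine Finset.sum_le_card_nsmul _ _ _ fun p hp => hM.sum_le_card_add_two hL hp fun z hz => ?_
  rw [ite_both, ite_both]
  simp only [tailExcess, edgeColors, ColorSet.tailSize]
  cases g₂ p.1 z <;> cases g₂ p.2 z <;> cases g₃ p.1 z <;> cases g₃ p.2 z <;> simp

theorem boxSum_L_L_nonpos (hd : IsDecomposition g₁ g₂ g₃ T A B C U L) :
    boxSum (totalExcess g₁ g₂ g₃) L L ≤ 0 :=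
  Finset.sum_nonpos fun x hx => Finset.sum_nonpos fun y hy => by
    have := hd.size_le_one x hx y hy
    rw [totalExcess]; omega

theorem boxSum_tailExcess_L_L_nonpos (hd : IsDecomposition g₁ g₂ g₃ T A B C U L) :
    boxSum (tailExcess g₁ g₂ g₃) L L ≤ 0 :=
  Finset.sum_nonpos fun x hx => Finset.sum_nonpos fun y hy => by
    have := hd.size_le_one x hx y hy
    simp only [tailExcess, edgeColors, ColorSet.size, ColorSet.tailSize] at this ⊢
    omega

theorem boxSum_T_le (hd : IsDecomposition g₁ g₂ g₃ T A B C U L) (X : Finset V) :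
    boxSum (totalExcess g₁ g₂ g₃) (coveredBy T) X ≤ T.card * X.card := by
  rw [hd.matching.boxSum_coveredBy_left, ← nsmul_eq_mul]
  refine Finset.sum_le_card_nsmul _ _ _ fun p hp => ?_
  have : ∑ z ∈ X, (totalExcess g₁ g₂ g₃ p.1 z + totalExcess g₁ g₂ g₃ p.2 z) ≤ ∑ z ∈ X, 1 := by
    refine Finset.sum_le_sum fun z _ => ?_
    obtain ⟨-, -, -, h1, h2, h3⟩ := hd.matching.1 p hp
    have := ColorSet.size_star_triple (edgeColors g₁ g₂ g₃ p.1 z) (edgeColors g₁ g₂ g₃ p.2 z)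
      (by simpa [edgeColors, h1, h2, h3] using hd.rainbowFree.compatible p.1 p.2 z)
    simp only [totalExcess]
    omega
  simpa using this

omit [DecidableEq V] [Fintype V] in
theorem boxSum_tailExcess_nonpos [DecidableEq V] (h : IsRainbowFree g₁ g₂ g₃)
    {R : V → V → Prop} {W : Finset V}
    {M : Finset (V × V)} (hM : IsPairMatching R W M)
    (hR : ∀ p ∈ M, g₁ p.1 p.2 && (g₂ p.1 p.2 || g₃ p.1 p.2)) (X : Finset V) :
    boxSum (tailExcess g₁ g₂ g₃) (coveredBy M) X ≤ 0 := by
  rw [hM.boxSum_coveredBy_left]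
  refine Finset.sum_nonpos fun p hp => Finset.sum_nonpos fun z _ => ?_
  have := ColorSet.tailSize_star _ _ _ (hR p hp) (h.compatible p.1 p.2 z)
  simp only [tailExcess]
  omega

theorem boxSum_tailExcess_univ_le (hd : IsDecomposition g₁ g₂ g₃ T A B C U L) :
    boxSum (tailExcess g₁ g₂ g₃) Finset.univ Finset.univ ≤
      4 * C.card ^ 2 + 2 * C.card * (L.card + 2) -
        2 * gainCount (totalExcess g₁ g₂ g₃) A B := by
  have hr := hd.rainbowFree
  obtain ⟨WA, -, hA, -⟩ := hd.max_A
  obtain ⟨WB, -, hB, -⟩ := hd.max_B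
  obtain ⟨WC, -, hC, -⟩ := hd.max_C
  have hT0 := boxSum_tailExcess_nonpos hr hd.matching fun p hp => by
    simp [(hd.matching.1 p hp).2.2.2]
  have hA0 := boxSum_tailExcess_nonpos hr hA.1 fun p hp => by
    have := (hA.1.1 p hp).2.2.2
    simp [this.1, this.2]
  have hB0 := boxSum_tailExcess_nonpos hr hB.1 fun p hp => by
    have := (hB.1.1 p hp).2.2.2
    simp [this.1, this.2]
  have hAB : boxSum (tailExcess g₁ g₂ g₃) (coveredBy A) (coveredBy B) ≤
      -gainCount (totalExcess g₁ g₂ g₃) A B := by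
    rw [hA.1.boxSum_coveredBy hB.1, gainCount, ← Finset.sum_neg_distrib]
    refine Finset.sum_le_sum fun p hp => ?_
    rw [← Finset.sum_neg_distrib]
    refine Finset.sum_le_sum fun q hq => ?_
    split_ifs with h
    · exact (hd.block_A_B hp hq).2 h
    · have hp' := hA.1.1 p hp
      have h1 := ColorSet.tailSize_star _ _ _ (by simp [edgeColors, hp'.2.2.2.1, hp'.2.2.2.2])
        (hr.compatible p.1 p.2 q.1)
      have h2 := ColorSet.tailSize_star _ _ _ (by simp [edgeColors, hp'.2.2.2.1, hp'.2.2.2.2])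
        (hr.compatible p.1 p.2 q.2)
      simp only [blockSum, tailExcess]
      omega
  have hCC : boxSum (tailExcess g₁ g₂ g₃) (coveredBy C) (coveredBy C) ≤ 4 * C.card ^ 2 := by
    have : boxSum (tailExcess g₁ g₂ g₃) (coveredBy C) (coveredBy C) ≤
        boxSum (fun _ _ => 1) (coveredBy C) (coveredBy C) :=
      Finset.sum_le_sum fun x _ => Finset.sum_le_sum fun y _ => tailExcess_le _ _ _ x y
    refine this.trans_eq ?_
    simp only [boxSum, Finset.sum_const, nsmul_eq_mul, mul_one, hC.1.card_coveredBy]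
    ring
  rw [hd.boxSum_univ (tailExcess_comm hr)]
  have hCL := hd.boxSum_tailExcess_C_L_le
  have hLL := hd.boxSum_tailExcess_L_L_nonpos
  linarith [hT0 (coveredBy T), hT0 (coveredBy A), hT0 (coveredBy B), hT0 (coveredBy C), hT0 L,
    hA0 (coveredBy A), hA0 (coveredBy C), hA0 L, hB0 (coveredBy B), hB0 (coveredBy C), hB0 L]

theorem boxSum_A_B_le (hd : IsDecomposition g₁ g₂ g₃ T A B C U L) :
    boxSum (totalExcess g₁ g₂ g₃) (coveredBy A) (coveredBy B) ≤
      gainCount (totalExcess g₁ g₂ g₃) A B := by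
  obtain ⟨WA, -, hA, -⟩ := hd.max_A
  obtain ⟨WB, -, hB, -⟩ := hd.max_B
  rw [hA.1.boxSum_coveredBy hB.1]
  refine Finset.sum_le_sum fun p hp => Finset.sum_le_sum fun q hq => ?_
  have := (hd.block_A_B hp hq).1
  split_ifs <;> omega

theorem boxSum_B_C_le (hd : IsDecomposition g₁ g₂ g₃ T A B C U L) :
    boxSum (totalExcess g₁ g₂ g₃) (coveredBy B) (coveredBy C) ≤
      gainCount (totalExcess g₁ g₂ g₃) B C := by
  obtain ⟨WB, -, hB, -⟩ := hd.max_B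
  obtain ⟨WC, -, hC, -⟩ := hd.max_C
  rw [hB.1.boxSum_coveredBy hC.1]
  refine Finset.sum_le_sum fun p hp => Finset.sum_le_sum fun q hq => ?_
  have := (hd.block_B_C hp hq).1
  split_ifs <;> omega

theorem boxSum_totalExcess_univ_le (hd : IsDecomposition g₁ g₂ g₃ T A B C U L) :
    ∃ σ : ℤ, 0 ≤ σ ∧ σ ≤ A.card ∧
      boxSum (totalExcess g₁ g₂ g₃) Finset.univ Finset.univ ≤
        4 * A.card ^ 2 - σ ^ 2 + 2 * σ * L.card + 4 * A.card + 4 * B.card ^ 2 + 4 * C.card ^ 2 +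
        2 * B.card * (L.card + 2) + 2 * C.card * (L.card + 2) +
        2 * gainCount (totalExcess g₁ g₂ g₃) A B + 2 * gainCount (totalExcess g₁ g₂ g₃) A C +
        2 * T.card ^ 2 + 2 * T.card * (2 * A.card + 2 * B.card + 2 * C.card + L.card) := by
  obtain ⟨σ, h0, h1, hAL⟩ := hd.boxSum_A_A_add_two_mul_boxSum_A_L
  refine ⟨σ, h0, h1, ?_⟩
  have hcomm := totalExcess_comm hd.rainbowFree
  have hBB := hd.boxSum_B_B_le
  have hCC := hd.swap.boxSum_B_B_le
  have hBL := hd.boxSum_B_L_le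
  have hCL := hd.swap.boxSum_B_L_le
  have hAB := hd.boxSum_A_B_le
  have hAC := hd.swap.boxSum_A_B_le
  rw [totalExcess_swap_left] at hCC hCL hAC
  have hBC := hd.boxSum_B_C_le
  have hLL := hd.boxSum_L_L_nonpos
  have hG := two_mul_gainCount_le hcomm B C
  have hTT := hd.boxSum_T_le (coveredBy T)
  have hTA := hd.boxSum_T_le (coveredBy A)
  have hTB := hd.boxSum_T_le (coveredBy B)
  have hTC := hd.boxSum_T_le (coveredBy C)
  have hTL := hd.boxSum_T_le L
  obtain ⟨WA, -, hA, -⟩ := hd.max_A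
  obtain ⟨WB, -, hB, -⟩ := hd.max_B
  obtain ⟨WC, -, hC, -⟩ := hd.max_C
  rw [hd.matching.card_coveredBy] at hTT
  rw [hA.1.card_coveredBy] at hTA
  rw [hB.1.card_coveredBy] at hTB
  rw [hC.1.card_coveredBy] at hTC
  rw [hd.boxSum_univ hcomm]
  linarith

end IsDecomposition

end Decomposition

theorem not_dense_of_matching_bounds {τ N T A B C L σ g₁ g₂ s : ℝ} (hτ : 9 * τ ^ 2 - 8 * τ + 1 = 0)
    (hτ₀ : 0.15 < τ) (hτ₁ : τ < 0.151) (hN : 0 < N) (hT : 0 ≤ T) (hB : 0 ≤ B) (hC : 0 ≤ C)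
    (hL : 0 ≤ L) (hBA : B ≤ A) (hCA : C ≤ A) (hsum : 2 * T + 2 * A + 2 * B + 2 * C + L = N)
    (hσA : σ ≤ A) (hσ : 0 ≤ σ) (hg₁ : 0 ≤ g₁) (hg₂ : 0 ≤ g₂) (hg₁' : g₁ ≤ A * B)
    (hg₂' : g₂ ≤ A * C)
    (h₁ : τ ^ 2 * N ^ 2 + 6 * N < 4 * C ^ 2 + 2 * C * (L + 2) - 2 * g₁)
    (h₂ : τ ^ 2 * N ^ 2 + 6 * N < 4 * B ^ 2 + 2 * B * (L + 2) - 2 * g₂)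
    (hs : (1 + 3 * τ ^ 2) / 2 * N ^ 2 + 9 * N < s) :
    ¬ s ≤ 4 * A ^ 2 - σ ^ 2 + 2 * σ * L + 4 * A + 4 * B ^ 2 + 4 * C ^ 2 +
      2 * B * (L + 2) + 2 * C * (L + 2) + 2 * g₁ + 2 * g₂ + 2 * T ^ 2 +
      2 * T * (2 * A + 2 * B + 2 * C + L) := by
  intro h₃
  have scale : ∀ x : ℝ, ∃ z, x = z * N := fun x => ⟨x / N, by field_simp⟩
  have scale₂ : ∀ x : ℝ, ∃ z, x = z * N ^ 2 := fun x => ⟨x / N ^ 2, by field_simp⟩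
  have hN2 : 0 < N ^ 2 := by positivity
  obtain ⟨a, ha⟩ := scale (2 * A)
  obtain ⟨b, hb⟩ := scale (2 * B)
  obtain ⟨c, hc⟩ := scale (2 * C)
  obtain ⟨y, hy⟩ := scale (2 * T)
  obtain ⟨l, rfl⟩ := scale L
  obtain ⟨r, rfl⟩ := scale σ
  obtain ⟨G₁, rfl⟩ := scale₂ g₁
  obtain ⟨G₂, rfl⟩ := scale₂ g₂
  obtain rfl : A = a * N / 2 := by linarith
  obtain rfl : B = b * N / 2 := by linarith
  obtain rfl : C = c * N / 2 := by linarith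
  obtain rfl : T = y * N / 2 := by linarith
  have hb0 : 0 ≤ b := le_of_mul_le_mul_right (by linarith) hN
  have hc0 : 0 ≤ c := le_of_mul_le_mul_right (by linarith) hN
  have hl0 : 0 ≤ l := le_of_mul_le_mul_right (by linarith) hN
  have hy0 : 0 ≤ y := le_of_mul_le_mul_right (by linarith) hN
  have hr0 : 0 ≤ r := le_of_mul_le_mul_right (by linarith) hN
  have hba : b ≤ a := le_of_mul_le_mul_right (by linarith) hN
  have hca : c ≤ a := le_of_mul_le_mul_right (by linarith) hN
  have hra : r ≤ a / 2 := le_of_mul_le_mul_right (by linarith) hN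
  have hG₁ : 0 ≤ G₁ := le_of_mul_le_mul_right (by linarith) hN2
  have hG₂ : 0 ≤ G₂ := le_of_mul_le_mul_right (by linarith) hN2
  have hG₁' : 2 * G₁ ≤ a * b / 2 := le_of_mul_le_mul_right (by linarith) hN2
  have hG₂' : 2 * G₂ ≤ a * c / 2 := le_of_mul_le_mul_right (by linarith) hN2
  have hsum' : a + b + c + l + y = 1 :=
    mul_right_cancel₀ hN.ne' (by linarith)
  have hc2 : τ ^ 2 + 2 * G₁ ≤ c ^ 2 + c * l := le_of_mul_le_mul_right (by linarith) hN2
  have hb2 : τ ^ 2 + 2 * G₂ ≤ b ^ 2 + b * l := le_of_mul_le_mul_right (by linarith) hN2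
  have hS : 2 * r * l - r ^ 2 ≤ l ^ 2 := by linarith [sq_nonneg (l - r)]
  have hS' : 2 * r * l - r ^ 2 ≤ a * l := by
    have := mul_le_mul_of_nonneg_right hra hl0
    linarith [sq_nonneg r]
  have key : a ^ 2 + (2 * r * l - r ^ 2) + b ^ 2 + c ^ 2 + (b + c) * l + 2 * G₁ + 2 * G₂ + y -
      y ^ 2 / 2 ≤ (1 + 3 * τ ^ 2) / 2 := by
    rcases le_total a ((1 + 2 * τ) / 3) with h | h
    · exact total_le_of_small hτ₀ hτ₁ hb0 hc0 hl0 hba hca hsum' hS hS' (by linarith)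
        (by linarith) h hG₁' hG₂'
    · exact total_le_of_large hτ hτ₀ hτ₁ hb0 hc0 hl0 hy0 hsum' hG₁ hG₂ hS hb2 hc2 h
  have key' := mul_le_mul_of_nonneg_right key hN2.le
  obtain rfl : a = 1 - b - c - l - y := by linarith
  linarith

section Existence

variable {V : Type*} [DecidableEq V] [Fintype V] {g₁ g₂ g₃ : V → V → Bool}
  {T A B C : Finset (V × V)} {U L : Finset V}

/-- The number of ordered pairs related by `g`. -/
def edgeCount (g : V → V → Bool) : ℤ := ∑ x, ∑ y, ((g x y).toNat : ℤ)

omit [DecidableEq V] in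
theorem boxSum_tailExcess_univ (g₁ g₂ g₃ : V → V → Bool) :
    boxSum (tailExcess g₁ g₂ g₃) Finset.univ Finset.univ =
      edgeCount g₂ + edgeCount g₃ - (Fintype.card V : ℤ) ^ 2 := by
  simp [boxSum, tailExcess, edgeColors, ColorSet.tailSize, edgeCount, Finset.sum_add_distrib,
    Finset.sum_sub_distrib, sq]

omit [DecidableEq V] in
theorem boxSum_totalExcess_univ (g₁ g₂ g₃ : V → V → Bool) :
    boxSum (totalExcess g₁ g₂ g₃) Finset.univ Finset.univ =
      edgeCount g₁ + edgeCount g₂ + edgeCount g₃ - (Fintype.card V : ℤ) ^ 2 := by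
  simp [boxSum, totalExcess, edgeColors, ColorSet.size, edgeCount, Finset.sum_add_distrib,
    Finset.sum_sub_distrib, sq]

theorem IsDecomposition.two_mul_card (hd : IsDecomposition g₁ g₂ g₃ T A B C U L) :
    2 * (T.card : ℤ) + 2 * A.card + 2 * B.card + 2 * C.card + L.card = Fintype.card V := by
  obtain ⟨WA, -, hA, -⟩ := hd.max_A
  obtain ⟨WB, -, hB, -⟩ := hd.max_B
  obtain ⟨WC, -, hC, -⟩ := hd.max_C
  have := hd.sum_eq fun _ => 1
  have hT := hd.matching.card_coveredBy
  have hA := hA.1.card_coveredBy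
  have hB := hB.1.card_coveredBy
  have hC := hC.1.card_coveredBy
  simp only [Finset.sum_const, Finset.card_univ, nsmul_eq_mul, mul_one] at this
  linarith

theorem IsDecomposition.not_dense (hd : IsDecomposition g₁ g₂ g₃ T A B C U L)
    (hBA : B.card ≤ A.card) (hCA : C.card ≤ A.card) {τ : ℝ} (hτ : 9 * τ ^ 2 - 8 * τ + 1 = 0)
    (hτ₀ : 0.15 < τ) (hτ₁ : τ < 0.151) [Nonempty V]
    (h₁ : (1 + τ ^ 2) / 2 * (Fintype.card V : ℝ) ^ 2 + 3 * Fintype.card V < edgeCount g₁)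
    (h₂ : (1 + τ ^ 2) / 2 * (Fintype.card V : ℝ) ^ 2 + 3 * Fintype.card V < edgeCount g₂)
    (h₃ : (1 + τ ^ 2) / 2 * (Fintype.card V : ℝ) ^ 2 + 3 * Fintype.card V < edgeCount g₃) :
    False := by
  have hN : (0 : ℝ) < Fintype.card V := by exact_mod_cast Fintype.card_pos
  have htail₁ := hd.boxSum_tailExcess_univ_le
  have htail₂ := hd.swap.boxSum_tailExcess_univ_le
  obtain ⟨σ, h0, hσ, htot⟩ := hd.boxSum_totalExcess_univ_le
  rw [totalExcess_swap_left] at htail₂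
  rw [boxSum_tailExcess_univ] at htail₁ htail₂
  rw [boxSum_totalExcess_univ] at htot
  have hg₁ := gainCount_nonneg (totalExcess g₁ g₂ g₃) A B
  have hg₂ := gainCount_nonneg (totalExcess g₁ g₂ g₃) A C
  have hg₁' := gainCount_le (totalExcess g₁ g₂ g₃) A B
  have hg₂' := gainCount_le (totalExcess g₁ g₂ g₃) A C
  have hsum := hd.two_mul_card
  generalize gainCount (totalExcess g₁ g₂ g₃) A B = G₁ at *
  generalize gainCount (totalExcess g₁ g₂ g₃) A C = G₂ at *
  rify at *
  refine not_dense_of_matching_bounds hτ hτ₀ hτ₁ hN (Nat.cast_nonneg T.card)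
    (Nat.cast_nonneg B.card) (Nat.cast_nonneg C.card) (Nat.cast_nonneg L.card) hBA hCA hsum hσ h0
    hg₁ hg₂ hg₁' hg₂' ?_ ?_ ?_ htot <;> linarith

omit [Fintype V] in
theorem sum_sdiff_coveredBy {R : V → V → Prop} {W : Finset V} {M : Finset (V × V)}
    (h : IsPairMatching R W M) (f : V → ℤ) :
    ∑ x ∈ W, f x = ∑ x ∈ coveredBy M, f x + ∑ x ∈ W \ coveredBy M, f x := by
  rw [add_comm, Finset.sum_sdiff h.coveredBy_subset]

theorem exists_isDecomposition (h : IsRainbowFree g₁ g₂ g₃)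
    (hT : IsMaxPairMatching (fun x y => g₁ x y = true ∧ g₂ x y = true ∧ g₃ x y = true)
      Finset.univ T)
    (hA : IsMaxPairMatching (Both g₁ g₂) (Finset.univ \ coveredBy T) A) :
    ∃ B C L, IsDecomposition g₁ g₂ g₃ T A B C (Finset.univ \ coveredBy T) L ∧
      IsPairMatching (Both g₁ g₃) (Finset.univ \ coveredBy T) B ∧
      IsPairMatching (Both g₂ g₃) (Finset.univ \ coveredBy T) C := by
  obtain ⟨B, hB⟩ :=
    exists_isMaxPairMatching (Both g₁ g₃) ((Finset.univ \ coveredBy T) \ coveredBy A)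
  obtain ⟨C, hC⟩ := exists_isMaxPairMatching (Both g₂ g₃)
    (((Finset.univ \ coveredBy T) \ coveredBy A) \ coveredBy B)
  have s₁ : (Finset.univ \ coveredBy T) \ coveredBy A ⊆ Finset.univ \ coveredBy T :=
    Finset.sdiff_subset
  have s₂ : ((Finset.univ \ coveredBy T) \ coveredBy A) \ coveredBy B ⊆
      (Finset.univ \ coveredBy T) \ coveredBy A := Finset.sdiff_subset
  have s₃ : (((Finset.univ \ coveredBy T) \ coveredBy A) \ coveredBy B) \ coveredBy C ⊆
      ((Finset.univ \ coveredBy T) \ coveredBy A) \ coveredBy B := Finset.sdiff_subset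
  refine ⟨B, C, _, ⟨h, ?_, ?_, ?_, hT.1, ⟨_, subset_rfl, hA, s₃.trans s₂⟩, ⟨_, s₁, hB, s₃⟩,
    ⟨_, s₂.trans s₁, hC, subset_rfl⟩⟩, hB.1.mono (fun _ _ => id) s₁,
    hC.1.mono (fun _ _ => id) (s₂.trans s₁)⟩
  · intro x hx y hy
    rcases eq_or_ne x y with rfl | hxy
    · simp [edgeColors, ColorSet.size, h.irrefl₁, h.irrefl₂, h.irrefl₃]
    · have := hT.not_rel hx hy hxy
      simp only [edgeColors, ColorSet.size]
      revert this
      cases g₁ x y <;> cases g₂ x y <;> cases g₃ x y <;> simp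
  · intro x hx y hy
    rcases eq_or_ne x y with rfl | hxy
    · simp [edgeColors, ColorSet.size, h.irrefl₁, h.irrefl₂, h.irrefl₃]
    · have h1 := hC.not_rel hx hy hxy
      have h2 := hB.not_rel (s₃ hx) (s₃ hy) hxy
      have h3 := hA.not_rel (s₂ (s₃ hx)) (s₂ (s₃ hy)) hxy
      simp only [edgeColors, ColorSet.size]
      simp only [Both] at h1 h2 h3
      revert h1 h2 h3
      cases g₁ x y <;> cases g₂ x y <;> cases g₃ x y <;> simp
  · intro f
    rw [sum_sdiff_coveredBy hT.1, sum_sdiff_coveredBy hA.1, sum_sdiff_coveredBy hB.1,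
      sum_sdiff_coveredBy hC.1]
    ring

theorem IsRainbowFree.not_dense_of_card_le (h : IsRainbowFree g₁ g₂ g₃)
    (hT : IsMaxPairMatching (fun x y => g₁ x y = true ∧ g₂ x y = true ∧ g₃ x y = true)
      Finset.univ T)
    (hA : IsMaxPairMatching (Both g₁ g₂) (Finset.univ \ coveredBy T) A)
    (hB : IsMaxPairMatching (Both g₁ g₃) (Finset.univ \ coveredBy T) B)
    (hC : IsMaxPairMatching (Both g₂ g₃) (Finset.univ \ coveredBy T) C)
    (hBA : B.card ≤ A.card) (hCA : C.card ≤ A.card) {τ : ℝ} (hτ : 9 * τ ^ 2 - 8 * τ + 1 = 0)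
    (hτ₀ : 0.15 < τ) (hτ₁ : τ < 0.151) [Nonempty V]
    (h₁ : (1 + τ ^ 2) / 2 * (Fintype.card V : ℝ) ^ 2 + 3 * Fintype.card V < edgeCount g₁)
    (h₂ : (1 + τ ^ 2) / 2 * (Fintype.card V : ℝ) ^ 2 + 3 * Fintype.card V < edgeCount g₂)
    (h₃ : (1 + τ ^ 2) / 2 * (Fintype.card V : ℝ) ^ 2 + 3 * Fintype.card V < edgeCount g₃) :
    False := by
  obtain ⟨B', C', L, hd, hB', hC'⟩ := exists_isDecomposition h hT hA
  exact hd.not_dense ((hB.2 _ hB').trans hBA) ((hC.2 _ hC').trans hCA) hτ hτ₀ hτ₁ h₁ h₂ h₃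

theorem IsRainbowFree.not_dense (h : IsRainbowFree g₁ g₂ g₃) {τ : ℝ}
    (hτ : 9 * τ ^ 2 - 8 * τ + 1 = 0) (hτ₀ : 0.15 < τ) (hτ₁ : τ < 0.151) [Nonempty V]
    (h₁ : (1 + τ ^ 2) / 2 * (Fintype.card V : ℝ) ^ 2 + 3 * Fintype.card V < edgeCount g₁)
    (h₂ : (1 + τ ^ 2) / 2 * (Fintype.card V : ℝ) ^ 2 + 3 * Fintype.card V < edgeCount g₂)
    (h₃ : (1 + τ ^ 2) / 2 * (Fintype.card V : ℝ) ^ 2 + 3 * Fintype.card V < edgeCount g₃) :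
    False := by
  obtain ⟨T, hT⟩ := exists_isMaxPairMatching
    (fun x y => g₁ x y = true ∧ g₂ x y = true ∧ g₃ x y = true) Finset.univ
  obtain ⟨A, hA⟩ := exists_isMaxPairMatching (Both g₁ g₂) (Finset.univ \ coveredBy T)
  obtain ⟨B, hB⟩ := exists_isMaxPairMatching (Both g₁ g₃) (Finset.univ \ coveredBy T)
  obtain ⟨C, hC⟩ := exists_isMaxPairMatching (Both g₂ g₃) (Finset.univ \ coveredBy T)
  by_cases hBA : B.card ≤ A.card
  · by_cases hCA : C.card ≤ A.card
    · exact h.not_dense_of_card_le hT hA hB hC hBA hCA hτ hτ₀ hτ₁ h₁ h₂ h₃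
    · refine h.swap_left.swap_right.not_dense_of_card_le (T := T) ?_ hC (both_comm g₁ g₂ ▸ hA)
        (both_comm g₁ g₃ ▸ hB) (by omega) (by omega) hτ hτ₀ hτ₁ h₂ h₃ h₁
      convert hT using 3
      tauto
  · by_cases hCB : C.card ≤ B.card
    · refine h.swap_right.not_dense_of_card_le (T := T) ?_ hB hA
        (both_comm g₂ g₃ ▸ hC) (by omega) (by omega) hτ hτ₀ hτ₁ h₁ h₃ h₂
      convert hT using 3
      tauto
    · refine h.swap_left.swap_right.not_dense_of_card_le (T := T) ?_ hC (both_comm g₁ g₂ ▸ hA)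
        (both_comm g₁ g₃ ▸ hB) (by omega) (by omega) hτ hτ₀ hτ₁ h₂ h₃ h₁
      convert hT using 3
      tauto

end Existence

section Doubling

variable {n : ℕ}

/-- The position of a doubled vertex in the palindromic order `0, 1, …, n-1, n-1, …, 1, 0`. -/
def palindromicRank (x : Fin n × Bool) : ℤ := if x.2 then n - x.1 else x.1 - n

/-- `x` precedes `y` in the palindromic order and the edge from `x` to `y` belongs to `G`. -/
def IsForwardEdge (G : Finset (Fin n × Fin n)) (x y : Fin n × Bool) : Prop :=
  palindromicRank x < palindromicRank y ∧ (x.1, y.1) ∈ G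

instance (G : Finset (Fin n × Fin n)) : DecidableRel (IsForwardEdge G) :=
  fun _ _ => inferInstanceAs (Decidable (_ ∧ _))

/-- The symmetric relation on doubled vertices given by the forward edges of `G`. -/
def doubling (G : Finset (Fin n × Fin n)) (x y : Fin n × Bool) : Bool :=
  decide (IsForwardEdge G x y ∨ IsForwardEdge G y x)

theorem doubling_comm (G : Finset (Fin n × Fin n)) (x y : Fin n × Bool) :
    doubling G x y = doubling G y x := by
  simp [doubling, or_comm]

theorem doubling_self (G : Finset (Fin n × Fin n)) (x : Fin n × Bool) :
    doubling G x x = false := by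
  simp [doubling, IsForwardEdge]

theorem sum_isForwardEdge {G : Finset (Fin n × Fin n)} (hloop : ∀ e ∈ G, e.1 ≠ e.2) (u v : Fin n) :
    ∑ s : Bool, ∑ t : Bool, (if IsForwardEdge G (u, s) (v, t) then (1 : ℤ) else 0) =
      if (u, v) ∈ G then 2 else 0 := by
  by_cases h : (u, v) ∈ G
  · have huv : (u : ℕ) ≠ v := fun e => hloop _ h (Fin.ext e)
    have hu := u.2
    have hv := v.2
    simp only [IsForwardEdge, palindromicRank, h, Fintype.sum_bool]
    rcases lt_or_gt_of_ne huv with huv | huv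
    · grind
    · grind
  · simp [IsForwardEdge, h]

theorem edgeCount_doubling {G : Finset (Fin n × Fin n)} (hloop : ∀ e ∈ G, e.1 ≠ e.2) :
    edgeCount (doubling G) = 4 * G.card := by
  have hsplit : ∀ x y, ((doubling G x y).toNat : ℤ) =
      (if IsForwardEdge G x y then 1 else 0) + (if IsForwardEdge G y x then 1 else 0) := by
    intro x y
    have : ¬ (IsForwardEdge G x y ∧ IsForwardEdge G y x) := fun h => h.1.1.asymm h.2.1
    by_cases h1 : IsForwardEdge G x y <;> by_cases h2 : IsForwardEdge G y x <;>
      simp_all [doubling]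
  have hforward : ∑ x : Fin n × Bool, ∑ y, (if IsForwardEdge G x y then (1 : ℤ) else 0) =
      2 * G.card := by
    simp only [Fintype.sum_prod_type]
    calc _ = ∑ u, ∑ v, ∑ s, ∑ t, (if IsForwardEdge G (u, s) (v, t) then (1 : ℤ) else 0) :=
          Finset.sum_congr rfl fun u _ => Finset.sum_comm
      _ = ∑ e : Fin n × Fin n, (if e ∈ G then 2 else 0) := by
          simp only [sum_isForwardEdge hloop, Fintype.sum_prod_type]
      _ = 2 * G.card := by simp [Finset.sum_ite_mem, mul_comm]
  simp only [edgeCount, hsplit, Finset.sum_add_distrib]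
  rw [hforward, Finset.sum_comm, hforward]
  ring

theorem isRainbowFree_doubling {G : Fin 3 → Finset (Fin n × Fin n)}
    (hloop : ∀ i : Fin 3, ∀ e ∈ G i, e.1 ≠ e.2)
    (h : ¬ ∃ u v w : Fin n, ∃ i j k : Fin 3,
      u ≠ v ∧ v ≠ w ∧ u ≠ w ∧ i ≠ j ∧ j ≠ k ∧ i ≠ k ∧
      (u, v) ∈ G i ∧ (v, w) ∈ G j ∧ (u, w) ∈ G k) :
    IsRainbowFree (doubling (G 0)) (doubling (G 1)) (doubling (G 2)) := by
  have key : ∀ u v w : Fin n, ∀ i j k : Fin 3, i ≠ j ∧ j ≠ k ∧ i ≠ k →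
      (u, v) ∈ G i → (v, w) ∈ G j → (u, w) ∈ G k → False :=
    fun u v w i j k hijk h1 h2 h3 => h ⟨u, v, w, i, j, k, hloop _ _ h1, hloop _ _ h2,
      hloop _ _ h3, hijk.1, hijk.2.1, hijk.2.2, h1, h2, h3⟩
  refine ⟨doubling_comm _, doubling_comm _, doubling_comm _, doubling_self _, doubling_self _,
    doubling_self _, ?_⟩
  rintro x y z ⟨h1, h2, h3⟩
  simp only [doubling, decide_eq_true_eq] at h1 h2 h3
  rcases h1 with ⟨r1, h1⟩ | ⟨r1, h1⟩ <;> rcases h2 with ⟨r2, h2⟩ | ⟨r2, h2⟩ <;>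
    rcases h3 with ⟨r3, h3⟩ | ⟨r3, h3⟩
  · exact key _ _ _ 0 1 2 (by decide) h1 h2 h3
  · omega
  · exact key _ _ _ 2 1 0 (by decide) h3 h2 h1
  · exact key _ _ _ 2 0 1 (by decide) h3 h1 h2
  · exact key _ _ _ 0 2 1 (by decide) h1 h3 h2
  · exact key _ _ _ 1 2 0 (by decide) h2 h3 h1
  · omega
  · exact key _ _ _ 1 0 2 (by decide) h2 h1 h3

end Doubling

theorem rainbow_transitive_triangle_three_colors
    (n : ℕ) (G : Fin 3 → Finset (Fin n × Fin n))
    (hloop : ∀ i : Fin 3, ∀ e ∈ G i, e.1 ≠ e.2)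
    (hE : ∀ i : Fin 3, ((G i).card : ℝ) >
        ((52 - 4 * Real.sqrt 7) / 81) * (n : ℝ) ^ 2 + (3 / 2 : ℝ) * (n : ℝ)) :
    ∃ u v w : Fin n, ∃ i j k : Fin 3,
      u ≠ v ∧ v ≠ w ∧ u ≠ w ∧ i ≠ j ∧ j ≠ k ∧ i ≠ k ∧
      (u, v) ∈ G i ∧ (v, w) ∈ G j ∧ (u, w) ∈ G k := by
  by_contra h
  have hfree := isRainbowFree_doubling hloop h
  have hsq : Real.sqrt 7 ^ 2 = 7 := Real.sq_sqrt (by norm_num)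
  have hlo : 2.645 < Real.sqrt 7 := Real.lt_sqrt (by norm_num) |>.2 (by norm_num)
  have hhi : Real.sqrt 7 < 2.646 := Real.sqrt_lt' (by norm_num) |>.2 (by norm_num)
  have hn : Nonempty (Fin n × Bool) := by
    by_contra hn
    rw [not_nonempty_iff] at hn
    have hcard := hE 0
    rcases n with - | n
    · simp [Finset.eq_empty_of_isEmpty (G 0)] at hcard
    · exact hn.false (0, true)
  have hdense : ∀ i, (1 + ((4 - Real.sqrt 7) / 9) ^ 2) / 2 * (Fintype.card (Fin n × Bool) : ℝ) ^ 2 +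
      3 * Fintype.card (Fin n × Bool) < edgeCount (doubling (G i)) := by
    intro i
    have hcard := hE i
    rw [edgeCount_doubling (hloop i)]
    simp only [Fintype.card_prod, Fintype.card_fin, Fintype.card_bool]
    push_cast
    have : (1 + ((4 - Real.sqrt 7) / 9) ^ 2) / 2 = (52 - 4 * Real.sqrt 7) / 81 := by
      linarith
    rw [this]
    linarith
  exact hfree.not_dense (by linarith) (by linarith) (by linarith) (hdense 0) (hdense 1) (hdense 2)
end

section
/- Let G_1, G_2, ..., G_c be c ≥ 3 oriented graphs on a common set of n vertices. If e(G_i) > (1/3)n^2 for every i ∈ {1,...,c}, then there exists a rainbow transitive triangle. -/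
open Finset

section WeightedPairs

variable {V : Type*} [DecidableEq V]

/-- Splitting the total weight of a symmetric weight function along a subset. -/
lemma sum_sum_eq_of_subset (w : V → V → ℕ) (hsymm : ∀ a b, w a b = w b a)
    {S T : Finset V} (hT : T ⊆ S) :
    ∑ a ∈ S, ∑ b ∈ S, w a b =
      ∑ a ∈ S \ T, ∑ b ∈ S \ T, w a b + 2 * ∑ a ∈ S \ T, ∑ b ∈ T, w a b +
        ∑ a ∈ T, ∑ b ∈ T, w a b := by
  have hcomm : ∑ a ∈ T, ∑ b ∈ S \ T, w a b = ∑ a ∈ S \ T, ∑ b ∈ T, w a b := by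
    rw [sum_comm]
    simp only [hsymm]
  have hsplit : ∀ a, ∑ b ∈ S, w a b = ∑ b ∈ S \ T, w a b + ∑ b ∈ T, w a b :=
    fun a => (sum_sdiff hT).symm
  rw [← sum_sdiff hT]
  simp only [hsplit, sum_add_distrib, hcomm]
  ring

/-- A symmetric weight function with values at most `3` has average value at most `2`, provided
that no vertex sends weight more than `6` to a triple formed by two pairs of weight `3` and
a pair of weight at least `2`. -/
lemma sum_sum_le_two_mul_card_sq (w : V → V → ℕ) (hsymm : ∀ a b, w a b = w b a)
    (hself : ∀ a, w a a = 0) (hle : ∀ a b, w a b ≤ 3)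
    (htriple : ∀ a m b x, w m a = 3 → w m b = 3 → 2 ≤ w a b →
      w x a + w x m + w x b ≤ 6) (S : Finset V) :
    ∑ a ∈ S, ∑ b ∈ S, w a b ≤ 2 * #S ^ 2 := by
  induction S using Finset.strongInduction with
  | H S ih =>
  by_cases hall : ∀ a ∈ S, ∀ b ∈ S, w a b ≤ 2
  · calc ∑ a ∈ S, ∑ b ∈ S, w a b ≤ ∑ a ∈ S, ∑ b ∈ S, 2 :=
          sum_le_sum fun a ha => sum_le_sum fun b hb => hall a ha b hb
      _ = 2 * #S ^ 2 := by simp only [sum_const, smul_eq_mul]; ring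
  push Not at hall
  obtain ⟨u, hu, v, hv, huv⟩ := hall
  have huv3 : w u v = 3 := le_antisymm (hle u v) huv
  have hne : u ≠ v := by
    rintro rfl
    simp [hself] at huv
  -- It suffices to find a set `T` of `t` vertices, of total weight at most `2 * t ^ 2`, to which
  -- every other vertex sends weight at most `2 * t`.
  have remove : ∀ T ⊆ S, T.Nonempty → ∑ a ∈ T, ∑ b ∈ T, w a b ≤ 2 * #T ^ 2 →
      (∀ x ∈ S \ T, ∑ b ∈ T, w x b ≤ 2 * #T) → ∑ a ∈ S, ∑ b ∈ S, w a b ≤ 2 * #S ^ 2 := by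
    intro T hT hTne hin hout
    have hrest := ih (S \ T) (sdiff_ssubset hT hTne)
    have hcross : ∑ a ∈ S \ T, ∑ b ∈ T, w a b ≤ #(S \ T) * (2 * #T) := by
      simpa using sum_le_card_nsmul _ _ _ hout
    have hcard : #(S \ T) + #T = #S := card_sdiff_add_card_eq_card hT
    rw [sum_sum_eq_of_subset w hsymm hT, ← hcard]
    nlinarith
  by_cases hpair : ∀ x ∈ S, w x u + w x v ≤ 4
  · refine remove {u, v} (by grind) (by simp) ?_ fun x hx => ?_
    · simp only [sum_pair hne, card_pair hne, hself, hsymm v u]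
      omega
    · rw [sum_pair hne, card_pair hne]
      exact hpair x (mem_sdiff.1 hx).1
  push Not at hpair
  obtain ⟨z, hz, hzuv⟩ := hpair
  have hzu := hle z u
  have hzv := hle z v
  have hu' : z ≠ u := by
    rintro rfl
    simp only [hself] at hzuv
    omega
  have hv' : z ≠ v := by
    rintro rfl
    simp only [hself] at hzuv
    omega
  have hcard : #{u, v, z} = 3 := card_eq_three.2 ⟨u, v, z, hne, hu'.symm, hv'.symm, rfl⟩
  have hsum : ∀ f : V → ℕ, ∑ b ∈ ({u, v, z} : Finset V), f b = f u + f v + f z := by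
    intro f
    rw [sum_insert (by grind), sum_pair hv'.symm, add_assoc]
  refine remove {u, v, z} (by grind) (by simp) ?_ fun x _ => ?_
  · simp only [hsum, hcard, hself, hsymm v u, hsymm u z, hsymm v z]
    omega
  · rw [hsum, hcard]
    rcases hzu.eq_or_lt with h | h
    · have := htriple v u z x huv3 (by rw [hsymm, h]) (by rw [hsymm]; omega)
      omega
    · have := htriple u v z x (by rw [hsymm, huv3]) (by rw [hsymm]; omega)
        (by rw [hsymm]; omega)
      omega

end WeightedPairs

section RainbowFree

variable {V : Type*} (p : Fin 3 → V → V → Prop)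

/-- No three arcs of distinct colours form a transitive triangle. -/
def RainbowTransitiveFree : Prop :=
  ∀ i j k : Fin 3, i ≠ j → j ≠ k → i ≠ k → ∀ u v w, p i u v → p j v w → ¬ p k u w

open Classical in
/-- The colours of the arcs between two vertices, in either direction. -/
noncomputable def pairColors (a b : V) : Finset (Fin 3) := {i | p i a b ∨ p i b a}

variable {p}

lemma mem_pairColors {i : Fin 3} {a b : V} : i ∈ pairColors p a b ↔ p i a b ∨ p i b a := by
  simp [pairColors]

lemma pairColors_comm (a b : V) : pairColors p a b = pairColors p b a := by
  ext i
  simp only [mem_pairColors, or_comm]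

lemma exists_third_color (i j : Fin 3) : ∃ k, k ≠ i ∧ k ≠ j := by
  decide +revert

/-- Two pairs carrying all colours and sharing `m`, closed up by a pair carrying two colours,
are coherently oriented through `m`. -/
lemma RainbowTransitiveFree.orientation (hp : RainbowTransitiveFree p) {a m b : V}
    (ha : ∀ i, p i m a ∨ p i a m) (hb : ∀ i, p i m b ∨ p i b m)
    (hab : 1 < #(pairColors p a b)) :
    (∀ i, p i a m ∧ p i m b) ∨ (∀ i, p i b m ∧ p i m a) := by
  obtain ⟨i, hi, j, hj, hij⟩ := one_lt_card.1 hab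
  rw [mem_pairColors] at hi hj
  obtain ⟨k, hki, hkj⟩ := exists_third_color i j
  have hcover : ∀ l, l = i ∨ l = j ∨ l = k := by
    clear hi hj
    omega
  have cyclic : ∀ r s t : Fin 3, r ≠ s → s ≠ t → r ≠ t →
      (p r b a → p s a m ∧ p t m b ∧ ¬ p s m a) ∧ (p r a b → p s m a ∧ p t b m ∧ ¬ p s a m) := by
    intro r s t hrs hst hrt
    have h₁ := ha s
    have h₂ := hb t
    have h := hp
    unfold RainbowTransitiveFree at h
    have := h r s t hrs hst hrt
    have := h r t s hrt hst.symm hrs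
    have := h s r t hrs.symm hrt hst
    have := h s t r hst hrt.symm hrs.symm
    have := h t r s hrt.symm hrs hst.symm
    have := h t s r hst.symm hrs.symm hrt.symm
    grind
  have c₁ := cyclic i j k hij hkj.symm hki.symm
  have c₂ := cyclic i k j hki.symm hkj hij
  have c₃ := cyclic j i k hij.symm hki.symm hkj.symm
  have c₄ := cyclic j k i hkj.symm hki hij.symm
  rcases hi with hi | hi
  · have hj : p j a b := by grind
    refine Or.inr fun l => ?_
    rcases hcover l with rfl | rfl | rfl <;> grind
  · have hj : p j b a := by grind
    refine Or.inl fun l => ?_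
    rcases hcover l with rfl | rfl | rfl <;> grind

/-- A vertex has few colours towards a triple as in `RainbowTransitiveFree.orientation`. -/
lemma RainbowTransitiveFree.card_pairColors_le_of_path (hp : RainbowTransitiveFree p)
    {a m b : V} (h : ∀ i, p i a m ∧ p i m b) (x : V) :
    #(pairColors p x a) + #(pairColors p x m) + #(pairColors p x b) ≤ 6 := by
  have key : ∀ i ∈ pairColors p x m, ∀ j ∈ pairColors p x a, ∀ k ∈ pairColors p x b,
      j ≠ i → k ≠ i → False := by
    intro i hi j hj k hk hji hki
    rw [mem_pairColors] at hi hj hk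
    obtain ⟨l, hli, hlj⟩ := exists_third_color i j
    obtain ⟨l', hli', hlk⟩ := exists_third_color i k
    rcases hi with hi | hi
    · rcases hj with hj | hj
      · exact hp j l i hlj.symm hli hji x a m hj (h l).1 hi
      · exact hp j i l hji hli.symm hlj.symm a x m hj hi (h l).1
    · rcases hk with hk | hk
      · exact hp i k l' hki.symm hlk.symm hli'.symm m x b hi hk (h l').2
      · exact hp l' k i hlk hki hli' m b x (h l').2 hk hi
  generalize pairColors p x a = A at *
  generalize pairColors p x m = M at *
  generalize pairColors p x b = B at *
  clear h hp
  decide +revert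

lemma RainbowTransitiveFree.card_pairColors_le (hp : RainbowTransitiveFree p) (a m b x : V)
    (ha : #(pairColors p m a) = 3) (hb : #(pairColors p m b) = 3)
    (hab : 2 ≤ #(pairColors p a b)) :
    #(pairColors p x a) + #(pairColors p x m) + #(pairColors p x b) ≤ 6 := by
  have full : ∀ c, #(pairColors p m c) = 3 → ∀ i, p i m c ∨ p i c m := fun c hc i => by
    rw [← mem_pairColors, (card_eq_iff_eq_univ (pairColors p m c)).1 (by simpa using hc)]
    exact mem_univ i
  rcases hp.orientation (full a ha) (full b hb) hab with h | h
  · exact hp.card_pairColors_le_of_path h x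
  · have := hp.card_pairColors_le_of_path h x
    omega

end RainbowFree


/-- If `c ≥ 3` oriented graphs (directed graphs with no double edges) on a common
set of `n` vertices each have more than `(1/3)n^2` edges, then there is a rainbow transitive
triangle. -/
theorem rainbow_transitive_triangle_oriented
    (n c : ℕ) (hc : 3 ≤ c) (G : Fin c → Finset (Fin n × Fin n))
    (hloop : ∀ i : Fin c, ∀ e ∈ G i, e.1 ≠ e.2)
    (horiented : ∀ i : Fin c, ∀ u v : Fin n, (u, v) ∈ G i → (v, u) ∉ G i)
    (hE : ∀ i : Fin c, ((G i).card : ℝ) > (1 / 3 : ℝ) * (n : ℝ) ^ 2) :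
    ∃ u v w : Fin n, ∃ i j k : Fin c,
      u ≠ v ∧ v ≠ w ∧ u ≠ w ∧ i ≠ j ∧ j ≠ k ∧ i ≠ k ∧
      (u, v) ∈ G i ∧ (v, w) ∈ G j ∧ (u, w) ∈ G k := by
  by_contra hcon
  let p : Fin 3 → Fin n → Fin n → Prop := fun i u v => (u, v) ∈ G (Fin.castLE hc i)
  have hcol : ∀ {i j : Fin 3}, i ≠ j → Fin.castLE hc i ≠ Fin.castLE hc j :=
    fun h => (Fin.castLE_injective hc).ne h
  have hp : RainbowTransitiveFree p := fun i j k hij hjk hik u v w huv hvw huw =>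
    hcon ⟨u, v, w, _, _, _, hloop _ _ huv, hloop _ _ hvw, hloop _ _ huw,
      hcol hij, hcol hjk, hcol hik, huv, hvw, huw⟩
  have hbound := sum_sum_le_two_mul_card_sq (fun a b => #(pairColors p a b))
    (fun a b => by rw [pairColors_comm])
    (fun a => card_eq_zero.2 <| eq_empty_of_forall_notMem fun i hi => by
      rw [mem_pairColors, or_self] at hi
      exact hloop _ _ hi rfl)
    (fun a b => card_le_univ _) hp.card_pairColors_le univ
  have hcount : ∑ a, ∑ b, #(pairColors p a b) = ∑ i, 2 * #(G (Fin.castLE hc i)) := by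
    have hpair : ∀ a b, #(pairColors p a b) = ∑ i : Fin 3,
        ((if (a, b) ∈ G (Fin.castLE hc i) then 1 else 0) +
          (if (b, a) ∈ G (Fin.castLE hc i) then 1 else 0)) := by
      intro a b
      rw [pairColors, card_filter]
      refine sum_congr rfl fun i _ => ?_
      have := horiented (Fin.castLE hc i) a b
      simp only [p]
      split_ifs <;> simp_all
    have harcs : ∀ H : Finset (Fin n × Fin n),
        ∑ a, ∑ b, (if (a, b) ∈ H then 1 else 0) = #H := by
      intro H
      rw [← Fintype.sum_prod_type' (f := fun a b => if (a, b) ∈ H then 1 else 0)]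
      simp
    simp only [hpair]
    simp_rw [sum_comm (t := (univ : Finset (Fin 3)))]
    refine sum_congr rfl fun i _ => ?_
    simp only [sum_add_distrib]
    rw [harcs, sum_comm, harcs, two_mul]
  rw [hcount, card_univ, Fintype.card_fin, Fin.sum_univ_three] at hbound
  have h₀ := hE (Fin.castLE hc 0)
  have h₁ := hE (Fin.castLE hc 1)
  have h₂ := hE (Fin.castLE hc 2)
  have hreal : ((2 * #(G (Fin.castLE hc 0)) + 2 * #(G (Fin.castLE hc 1)) +
      2 * #(G (Fin.castLE hc 2)) : ℕ) : ℝ) ≤ ((2 * n ^ 2 : ℕ) : ℝ) := by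
    exact_mod_cast hbound
  push_cast at hreal
  linarith
end

section
/- Let G_1, G_2, ..., G_c be c ≥ 4 directed graphs on a common set of n vertices. If the total number of edges satisfies e(G_1) + e(G_2) + ... + e(G_c) > (c/2)n^2, then there exists a rainbow directed triangle. -/
open Finset in
/-- Three finite sets of sizes at least `1`, `2`, `3` have distinct representatives. -/
theorem exists_distinct_representatives {α : Type*} [DecidableEq α] {X Y Z : Finset α}
    (hX : 1 ≤ #X) (hY : 2 ≤ #Y) (hZ : 3 ≤ #Z) :
    ∃ x ∈ X, ∃ y ∈ Y, ∃ z ∈ Z, x ≠ y ∧ y ≠ z ∧ x ≠ z := by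
  obtain ⟨x, hx⟩ := card_pos.mp hX
  obtain ⟨y, hy, hyx⟩ := exists_mem_ne hY x
  obtain ⟨z, hz, hz'⟩ := exists_mem_notMem_of_card_lt_card (s := {x, y}) (t := Z)
    (lt_of_le_of_lt card_le_two hZ)
  simp only [mem_insert, mem_singleton, not_or] at hz'
  exact ⟨x, hx, y, hy, z, hz, hyx.symm, Ne.symm hz'.2, Ne.symm hz'.1⟩

/-- An arc colouring assigning to each ordered pair a set of colours has no rainbow directed
triangle. -/
def RainbowTriangleFree {V α : Type*} (C : V → V → Finset α) : Prop :=
  ∀ u v w, u ≠ v → v ≠ w → u ≠ w → ∀ i ∈ C u v, ∀ j ∈ C v w, ∀ k ∈ C w u,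
    i ≠ j → j ≠ k → i ≠ k → False

/-- The number of colours, with multiplicity, on the two arcs between `u` and `v`. -/
def pairWeight {V α : Type*} (C : V → V → Finset α) (u v : V) : ℕ :=
  (C u v).card + (C v u).card

/-- All colours appear on the arc `uv` and exactly one appears on `vu`. -/
def HeavyArc {V α : Type*} [Fintype α] (C : V → V → Finset α) (u v : V) : Prop :=
  (C u v).card = Fintype.card α ∧ (C v u).card = 1

section

open Finset Classical

variable {V α : Type*} {C : V → V → Finset α}

theorem pairWeight_comm (C : V → V → Finset α) (u v : V) :
    pairWeight C u v = pairWeight C v u := Nat.add_comm _ _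

theorem RainbowTriangleFree.swap (h : RainbowTriangleFree C) :
    RainbowTriangleFree (fun u v => C v u) :=
  fun u v w huv hvw huw i hi j hj k hk hij hjk hik =>
    h u w v huw hvw.symm huv k hk j hj i hi hjk.symm hij.symm hik.symm

theorem RainbowTriangleFree.card_add_card_le [Fintype α] (h : RainbowTriangleFree C)
    (hα : 4 ≤ Fintype.card α) {u v w : V} (huv : u ≠ v) (hvw : v ≠ w) (huw : u ≠ w)
    (h2 : 2 ≤ #(C u v)) : #(C v w) + #(C w u) ≤ Fintype.card α := by
  by_contra! hlt
  have h1 := card_le_univ (C v w)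
  have h1' := card_le_univ (C w u)
  rcases le_or_gt 3 #(C v w) with h3 | h3
  · obtain ⟨k, hk, i, hi, j, hj, hki, hij, hkj⟩ :=
      exists_distinct_representatives (X := C w u) (by omega) h2 h3
    exact h u v w huv hvw huw i hi j hj k hk hij hkj.symm hki.symm
  · obtain ⟨j, hj, i, hi, k, hk, hji, hik, hjk⟩ :=
      exists_distinct_representatives (X := C v w) (Z := C w u) (by omega) h2 (by omega)
    exact h u v w huv hvw huw i hi j hj k hk hji.symm hjk hik

theorem RainbowTriangleFree.card_le_one (h : RainbowTriangleFree C)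
    {u v w : V} (huv : u ≠ v) (hvw : v ≠ w) (huw : u ≠ w)
    (h3 : 3 ≤ #(C u v)) (h1 : 1 ≤ #(C w u)) : #(C v w) ≤ 1 := by
  by_contra! hlt
  obtain ⟨k, hk, j, hj, i, hi, hkj, hji, hki⟩ := exists_distinct_representatives h1 hlt h3
  exact h u v w huv hvw huw i hi j hj k hk hji.symm hkj.symm hki.symm

theorem RainbowTriangleFree.pairWeight_le_two_of_heavyArc [Fintype α]
    (h : RainbowTriangleFree C) (hα : 4 ≤ Fintype.card α) {x y z : V} (hxy : x ≠ y)
    (hxz : x ≠ z) (hyz : y ≠ z) (hy : HeavyArc C x y) (hz : HeavyArc C x z) :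
    pairWeight C y z ≤ 2 := by
  obtain ⟨hy, hy'⟩ := hy
  obtain ⟨hz, hz'⟩ := hz
  have h1 := h.card_le_one hxy hyz hxz (by omega) (by omega)
  have h2 := h.card_le_one hxz hyz.symm hxy (by omega) (by omega)
  unfold pairWeight
  omega

theorem RainbowTriangleFree.pairWeight_add_pairWeight_le [Fintype α]
    (h : RainbowTriangleFree C) (hα : 4 ≤ Fintype.card α) {u v z : V} (huv : u ≠ v)
    (huz : u ≠ z) (hvz : v ≠ z) (h2 : 2 ≤ #(C u v)) (h2' : 2 ≤ #(C v u)) :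
    pairWeight C u z + pairWeight C v z ≤ 2 * Fintype.card α := by
  have h1 := h.card_add_card_le hα huv hvz huz h2
  have h1' := h.card_add_card_le hα huv.symm huz hvz h2'
  unfold pairWeight
  omega

theorem sum_sum_eq_sum_sum_erase_add [DecidableEq V] {f : V → V → ℕ}
    (hf : ∀ u v, f u v = f v u) (hf0 : ∀ u, f u u = 0) {S : Finset V} {x : V} (hx : x ∈ S) :
    ∑ u ∈ S, ∑ v ∈ S, f u v =
      ∑ u ∈ S.erase x, ∑ v ∈ S.erase x, f u v + 2 * ∑ v ∈ S.erase x, f x v := by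
  rw [← add_sum_erase _ _ hx, ← add_sum_erase _ _ hx, hf0]
  have : ∀ u ∈ S.erase x, ∑ v ∈ S, f u v = f x u + ∑ v ∈ S.erase x, f u v := by
    intro u _
    rw [← add_sum_erase _ _ hx, hf u x]
  rw [sum_congr rfl this, sum_add_distrib]
  ring

/-- If every pair has at most one colour in one of its directions, then the weighted degree of
`y` is governed by the heavy arcs and the light pairs at `y`. -/
theorem sum_pairWeight_add_le [Fintype α] (hα : 4 ≤ Fintype.card α) (S : Finset V) {y : V}
    (hy : y ∈ S) (hmin : ∀ v ∈ S, y ≠ v → #(C y v) ≤ 1 ∨ #(C v y) ≤ 1) :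
    ∑ v ∈ S.erase y, pairWeight C y v + 2 * #{v ∈ S.erase y | pairWeight C y v ≤ 2} ≤
      Fintype.card α * (#S - 1) + #{v ∈ S.erase y | HeavyArc C y v} +
        #{v ∈ S.erase y | HeavyArc C v y} := by
  rw [card_filter, card_filter, card_filter, mul_sum, ← sum_add_distrib, ← card_erase_of_mem hy,
    mul_comm, ← smul_eq_mul, ← sum_const, ← sum_add_distrib, ← sum_add_distrib]
  refine sum_le_sum fun v hv => ?_
  have h1 := card_le_univ (C y v)
  have h2 := card_le_univ (C v y)
  have h3 := hmin v (mem_of_mem_erase hv) (ne_of_mem_erase hv).symm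
  unfold pairWeight HeavyArc
  split_ifs <;> omega

/-- The members of a star of pairwise light vertices have many light partners. -/
theorem card_le_card_light_add_one {S N : Finset V} {y : V} (hN : N ⊆ S)
    (hy : y ∈ N) (h : ∀ z ∈ N, y ≠ z → pairWeight C y z ≤ 2) :
    #N ≤ #{v ∈ S.erase y | pairWeight C y v ≤ 2} + 1 := by
  have : N.erase y ⊆ {v ∈ S.erase y | pairWeight C y v ≤ 2} := by
    intro z hz
    rw [mem_erase] at hz
    rw [mem_filter, mem_erase]
    exact ⟨⟨hz.1, hN hz.2⟩, h z hz.2 hz.1.symm⟩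
  have h1 := card_le_card this
  rw [card_erase_of_mem hy] at h1
  omega

/-- If no two opposite arcs both carry two colours, some vertex has small weighted degree. -/
theorem RainbowTriangleFree.exists_two_mul_sum_pairWeight_le [Fintype α]
    (h : RainbowTriangleFree C) (hα : 4 ≤ Fintype.card α) {S : Finset V} (hS : S.Nonempty)
    (hmin : ∀ u ∈ S, ∀ v ∈ S, u ≠ v → #(C u v) ≤ 1 ∨ #(C v u) ≤ 1) :
    ∃ y ∈ S, 2 * ∑ v ∈ S.erase y, pairWeight C y v ≤
      2 * (Fintype.card α * (#S - 1)) + Fintype.card α := by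
  obtain ⟨p, hp, hpmax⟩ := exists_max_image S (fun x => #{v ∈ S.erase x | HeavyArc C x v}) hS
  obtain ⟨q, hq, hqmax⟩ := exists_max_image S (fun x => #{v ∈ S.erase x | HeavyArc C v x}) hS
  rcases Nat.eq_zero_or_pos
    (max #{v ∈ S.erase p | HeavyArc C p v} #{v ∈ S.erase q | HeavyArc C v q}) with h0 | h0
  · have h1 := sum_pairWeight_add_le hα S hp (hmin p hp)
    have h2 := hqmax p hp
    exact ⟨p, hp, by omega⟩
  · rcases le_total #{v ∈ S.erase q | HeavyArc C v q} #{v ∈ S.erase p | HeavyArc C p v}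
      with hle | hle
    · obtain ⟨y, hy⟩ := card_pos.mp (show 0 < #{v ∈ S.erase p | HeavyArc C p v} by omega)
      have hN : {v ∈ S.erase p | HeavyArc C p v} ⊆ S :=
        (filter_subset _ _).trans (erase_subset _ _)
      have hlight := card_le_card_light_add_one (C := C) hN hy fun z hz hyz => by
        simp only [mem_filter, mem_erase] at hy hz
        exact h.pairWeight_le_two_of_heavyArc hα hy.1.1.symm hz.1.1.symm hyz hy.2 hz.2
      have h1 := sum_pairWeight_add_le hα S (hN hy) (hmin y (hN hy))
      have h2 := hqmax y (hN hy)
      have h3 := hpmax y (hN hy)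
      exact ⟨y, hN hy, by omega⟩
    · obtain ⟨y, hy⟩ := card_pos.mp (show 0 < #{v ∈ S.erase q | HeavyArc C v q} by omega)
      have hN : {v ∈ S.erase q | HeavyArc C v q} ⊆ S :=
        (filter_subset _ _).trans (erase_subset _ _)
      have hlight := card_le_card_light_add_one (C := C) hN hy fun z hz hyz => by
        simp only [mem_filter, mem_erase] at hy hz
        rw [pairWeight_comm]
        exact h.swap.pairWeight_le_two_of_heavyArc hα hy.1.1.symm hz.1.1.symm hyz hy.2 hz.2
      have h1 := sum_pairWeight_add_le hα S (hN hy) (hmin y (hN hy))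
      have h2 := hqmax y (hN hy)
      have h3 := hpmax y (hN hy)
      exact ⟨y, hN hy, by omega⟩

theorem RainbowTriangleFree.sum_sum_pairWeight_le [Fintype α]
    (h : RainbowTriangleFree C) (hα : 4 ≤ Fintype.card α) (hC : ∀ u, C u u = ∅)
    (S : Finset V) :
    ∑ u ∈ S, ∑ v ∈ S, pairWeight C u v ≤ Fintype.card α * #S ^ 2 := by
  have hw0 : ∀ u, pairWeight C u u = 0 := fun u => by simp [pairWeight, hC]
  induction S using Finset.strongInduction with
  | H S ih =>
  rcases S.eq_empty_or_nonempty with rfl | hS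
  · simp
  by_cases hmin : ∀ u ∈ S, ∀ v ∈ S, u ≠ v → #(C u v) ≤ 1 ∨ #(C v u) ≤ 1
  · obtain ⟨y, hy, hdeg⟩ := h.exists_two_mul_sum_pairWeight_le hα hS hmin
    have h1 := ih _ (erase_ssubset hy)
    have hk := card_erase_add_one hy
    rw [sum_sum_eq_sum_sum_erase_add (pairWeight_comm C) hw0 hy]
    rw [← hk, Nat.add_sub_cancel] at hdeg
    rw [← hk]
    nlinarith
  · push Not at hmin
    obtain ⟨u, hu, v, hv, huv, h2, h2'⟩ := hmin
    have hv' : v ∈ S.erase u := mem_erase.mpr ⟨huv.symm, hv⟩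
    have h1 := ih _ ((erase_ssubset hv').trans (erase_ssubset hu))
    have hk := card_erase_add_one hu
    have hk' := card_erase_add_one hv'
    rw [sum_sum_eq_sum_sum_erase_add (pairWeight_comm C) hw0 hu,
      sum_sum_eq_sum_sum_erase_add (pairWeight_comm C) hw0 hv', ← add_sum_erase _ _ hv']
    have hout : ∑ z ∈ (S.erase u).erase v, pairWeight C u z +
        ∑ z ∈ (S.erase u).erase v, pairWeight C v z ≤
          #((S.erase u).erase v) * (2 * Fintype.card α) := by
      rw [← sum_add_distrib, ← smul_eq_mul]
      refine sum_le_card_nsmul _ _ _ fun z hz => ?_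
      simp only [mem_erase] at hz
      exact h.pairWeight_add_pairWeight_le hα huv hz.2.1.symm hz.1.symm h2 h2'
    have huvw : pairWeight C u v ≤ 2 * Fintype.card α := by
      have h3 := card_le_univ (C u v)
      have h4 := card_le_univ (C v u)
      unfold pairWeight
      omega
    rw [← hk, ← hk']
    nlinarith

end

/-- If `c ≥ 4` directed graphs on a common set of `n` vertices have in total more
than `(c/2)n^2` edges, then there is a rainbow directed triangle. -/
theorem rainbow_directed_triangle_total_edges
    (n c : ℕ) (hc : 4 ≤ c) (G : Fin c → Finset (Fin n × Fin n))
    (hloop : ∀ i : Fin c, ∀ e ∈ G i, e.1 ≠ e.2)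
    (hE : (∑ i : Fin c, ((G i).card : ℝ)) > ((c : ℝ) / 2) * (n : ℝ) ^ 2) :
    ∃ u v w : Fin n, ∃ i j k : Fin c,
      u ≠ v ∧ v ≠ w ∧ u ≠ w ∧ i ≠ j ∧ j ≠ k ∧ i ≠ k ∧
      (u, v) ∈ G i ∧ (v, w) ∈ G j ∧ (w, u) ∈ G k := by
  classical
  by_contra hcon
  let C : Fin n → Fin n → Finset (Fin c) := fun u v => {i | (u, v) ∈ G i}
  have hfree : RainbowTriangleFree C := by
    intro u v w huv hvw huw i hi j hj k hk hij hjk hik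
    simp only [C, Finset.mem_filter, Finset.mem_univ, true_and] at hi hj hk
    exact hcon ⟨u, v, w, i, j, k, huv, hvw, huw, hij, hjk, hik, hi, hj, hk⟩
  have hC : ∀ u, C u u = ∅ := by
    intro u
    ext i
    simpa [C] using fun hi => hloop i _ hi rfl
  have hbound := hfree.sum_sum_pairWeight_le (by simpa using hc) hC Finset.univ
  have hcount : ∑ u, ∑ v, (C u v).card = ∑ i, (G i).card := by
    simp only [C, Finset.card_filter]
    rw [← Fintype.sum_prod_type', Finset.sum_comm]
    simp
  simp only [pairWeight, Finset.sum_add_distrib] at hbound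
  rw [Finset.sum_comm (f := fun u v => (C v u).card), hcount, Fintype.card_fin,
    Finset.card_fin] at hbound
  have hreal : (∑ i, ((G i).card : ℝ)) + ∑ i, ((G i).card : ℝ) ≤ (c : ℝ) * (n : ℝ) ^ 2 := by
    exact_mod_cast hbound
  linarith
end

section
/- Let G_1, G_2, ..., G_c be c ≥ 4 directed graphs on a common set of n vertices. If the total number of edges satisfies e(G_1) + e(G_2) + ... + e(G_c) > (c/2)n^2, then there exists a rainbow transitive triangle. -/
/-- `A u v` is the set of colors on the edge `u → v`; the system has no rainbow transitive
triangle. -/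
def RainbowTransitiveTriangleFree {V κ : Type*} (A : V → V → Finset κ) : Prop :=
  ∀ u v w : V, ∀ i j k : κ, u ≠ v → v ≠ w → u ≠ w → i ≠ j → j ≠ k → i ≠ k →
    i ∈ A u v → j ∈ A v w → k ∈ A u w → False

/-- If one of three color sets has at least three elements and the other two do not extend to a
system of distinct representatives, then these two are nearly trivial. -/
lemma card_cases_of_no_distinct_representatives {κ : Type*} [DecidableEq κ] {A P Q : Finset κ}
    (hA : 3 ≤ A.card)
    (h : ∀ a ∈ A, ∀ p ∈ P, ∀ q ∈ Q, p ≠ q → a ≠ p → a ≠ q → False) :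
    P.card = 0 ∨ Q.card = 0 ∨ (P.card ≤ 1 ∧ Q.card ≤ 1) := by
  have key : ∀ p ∈ P, ∀ q ∈ Q, p = q := by
    intro p hp q hq
    by_contra hpq
    obtain ⟨a, ha, ha'⟩ := Finset.exists_mem_notMem_of_card_lt_card
      (lt_of_le_of_lt (Finset.card_le_two (a := p) (b := q)) hA)
    simp only [Finset.mem_insert, Finset.mem_singleton, not_or] at ha'
    exact h a ha p hp q hq hpq ha'.1 ha'.2
  rcases P.eq_empty_or_nonempty with rfl | ⟨p, hp⟩
  · simp
  rcases Q.eq_empty_or_nonempty with rfl | ⟨q, hq⟩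
  · simp
  refine Or.inr (Or.inr ⟨?_, ?_⟩)
  · exact Finset.card_le_one.2 fun x hx y hy => (key x hx q hq).trans (key y hy q hq).symm
  · exact Finset.card_le_one.2 fun x hx y hy => (key p hp x hx).symm.trans (key p hp y hy)

/-- The endpoints of an edge with at least three colors send at most `2c` colored edges in total
to and from any third vertex. -/
lemma RainbowTransitiveTriangleFree.card_add_le {V κ : Type*} [Fintype κ] [DecidableEq κ]
    {A : V → V → Finset κ} (hA : RainbowTransitiveTriangleFree A) (hκ : 3 ≤ Fintype.card κ)
    {u v w : V} (huv : u ≠ v) (huw : u ≠ w) (hvw : v ≠ w) (h : 3 ≤ (A u v).card) :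
    (A u w).card + (A w u).card + (A v w).card + (A w v).card ≤ 2 * Fintype.card κ := by
  have h₁ := card_cases_of_no_distinct_representatives (P := A u w) (Q := A v w) h
    fun a ha p hp q hq hpq hap haq =>
      hA u v w a q p huv hvw huw haq hpq.symm hap ha hq hp
  have h₂ := card_cases_of_no_distinct_representatives (P := A u w) (Q := A w v) h
    fun a ha p hp q hq hpq hap haq =>
      hA u w v p q a huw hvw.symm huv hpq haq.symm hap.symm hp hq ha
  have h₃ := card_cases_of_no_distinct_representatives (P := A w u) (Q := A w v) h
    fun a ha p hp q hq hpq hap haq =>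
      hA w u v p a q huw.symm huv hvw.symm hap.symm haq hpq hp ha hq
  have := (A u w).card_le_univ
  have := (A w u).card_le_univ
  have := (A v w).card_le_univ
  have := (A w v).card_le_univ
  omega

/-- The edges inside a vertex set `S`, counted with colors, number at most `(c/2)|S|^2`. -/
lemma RainbowTransitiveTriangleFree.two_mul_sum_card_le {V κ : Type*} [DecidableEq V] [Fintype κ]
    [DecidableEq κ] {A : V → V → Finset κ} (hA : RainbowTransitiveTriangleFree A)
    (hκ : 4 ≤ Fintype.card κ) (hloop : ∀ u, A u u = ∅) (S : Finset V) :
    2 * ∑ u ∈ S, ∑ v ∈ S, (A u v).card ≤ Fintype.card κ * S.card ^ 2 := by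
  induction S using Finset.strongInduction with
  | H S ih =>
  by_cases hS : ∃ u ∈ S, ∃ v ∈ S, 3 ≤ (A u v).card
  · obtain ⟨u, hu, v, hv, h⟩ := hS
    have huv : u ≠ v := by
      rintro rfl
      simp [hloop] at h
    obtain ⟨T, hvT, huT, rfl⟩ : ∃ T, v ∉ T ∧ u ∉ insert v T ∧ S = insert u (insert v T) :=
      ⟨(S.erase u).erase v, by simp, by simp [huv], by
        rw [Finset.insert_erase (by simp [huv.symm, hv]), Finset.insert_erase hu]⟩
    have hT := ih T ((Finset.ssubset_insert hvT).trans (Finset.ssubset_insert huT))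
    have hcross : ∑ w ∈ T, ((A u w).card + (A w u).card + (A v w).card + (A w v).card)
        ≤ T.card * (2 * Fintype.card κ) := by
      refine Finset.sum_le_card_nsmul _ _ _ fun w hw => hA.card_add_le (by omega) huv ?_ ?_ h
      · rintro rfl
        exact huT (Finset.mem_insert_of_mem hw)
      · rintro rfl
        exact hvT hw
    have h₁ := (A u v).card_le_univ
    have h₂ := (A v u).card_le_univ
    rw [Finset.card_insert_of_notMem huT, Finset.card_insert_of_notMem hvT]
    simp only [Finset.sum_insert huT, Finset.sum_insert hvT, Finset.sum_add_distrib, hloop,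
      Finset.card_empty] at hcross ⊢
    nlinarith
  · push Not at hS
    have hsum : ∑ u ∈ S, ∑ v ∈ S, (A u v).card ≤ S.card * (S.card * 2) :=
      Finset.sum_le_card_nsmul _ _ _ fun u hu =>
        Finset.sum_le_card_nsmul _ _ _ fun v hv => Nat.le_of_lt_succ (hS u hu v hv)
    nlinarith [Nat.mul_le_mul_right (S.card ^ 2) hκ]

/-- If `c ≥ 4` directed graphs on a common set of `n` vertices have in total more
than `(c/2)n^2` edges, then there is a rainbow transitive triangle. -/
theorem rainbow_transitive_triangle_total_edges
    (n c : ℕ) (hc : 4 ≤ c) (G : Fin c → Finset (Fin n × Fin n))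
    (hloop : ∀ i : Fin c, ∀ e ∈ G i, e.1 ≠ e.2)
    (hE : (∑ i : Fin c, ((G i).card : ℝ)) > ((c : ℝ) / 2) * (n : ℝ) ^ 2) :
    ∃ u v w : Fin n, ∃ i j k : Fin c,
      u ≠ v ∧ v ≠ w ∧ u ≠ w ∧ i ≠ j ∧ j ≠ k ∧ i ≠ k ∧
      (u, v) ∈ G i ∧ (v, w) ∈ G j ∧ (u, w) ∈ G k := by
  by_contra hno
  let A : Fin n → Fin n → Finset (Fin c) := fun u v => {i | (u, v) ∈ G i}
  have hA : RainbowTransitiveTriangleFree A := by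
    intro u v w i j k huv hvw huw hij hjk hik hi hj hk
    exact hno ⟨u, v, w, i, j, k, huv, hvw, huw, hij, hjk, hik,
      by simpa [A] using hi, by simpa [A] using hj, by simpa [A] using hk⟩
  have hbound := hA.two_mul_sum_card_le (by simpa using hc)
    (fun u => Finset.filter_eq_empty_iff.2 fun i _ hi => hloop i _ hi rfl) Finset.univ
  have hcount : ∑ u, ∑ v, (A u v).card = ∑ i, (G i).card := by
    rw [← Fintype.sum_prod_type']
    simp only [A, Finset.card_filter, Prod.mk.eta]
    rw [Finset.sum_comm]
    simp
  rw [hcount, Fintype.card_fin, Finset.card_fin] at hbound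
  have hreal : (2 : ℝ) * ∑ i, ((G i).card : ℝ) ≤ c * (n : ℝ) ^ 2 := by exact_mod_cast hbound
  linarith
end
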